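/- arXiv:1709.05053 — 6 statements merged into one kernel-verified Lean document; each statement's English description precedes it below -/
import Mathlib

section
/- Let σ ∈ {+1, −1} and 1 ≤ j ≤ n. There exists a solution x : ℝ → ℝ^{2n} of x′(t) = (A + E(t))·x(t) such that e^{−σt}·x(t) → e_j^σ as t → +∞. Thus for every eigenvector e_j^± of A there is a solution of the perturbed system asymptotic to the corresponding exponential solution e^{±t} e_j^± of the unperturbed system x′ = A x. -/
open Real Filter Topology

noncomputable section

/-- The phase space `ℝ^{2n} = ℝⁿ × ℝⁿ` with the Euclidean norm. -/
abbrev EucV (n : ℕ) := EuclideanSpace ℝ (Fin n ⊕ Fin n)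

/-- The block matrix `A = [[0, I],[I, 0]]`, i.e. `A (y, z) = (z, y)`. -/
def Amap (n : ℕ) : EucV n →L[ℝ] EucV n :=
  LinearMap.toContinuousLinearMap
    { toFun := fun x => (WithLp.equiv 2 _).symm fun i => x i.swap
      map_add' := fun x y => rfl
      map_smul' := fun c x => rfl }

/-- `x` is a solution of `x′(t) = (A + E(t))·x(t)`. -/
def IsSol (n : ℕ) (E : ℝ → (EucV n →L[ℝ] EucV n)) (x : ℝ → EucV n) : Prop :=
  ∀ t : ℝ, HasDerivAt x (Amap n (x t) + E t (x t)) t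

/-- The eigenvector `e_j^σ = (e_j, σ e_j)` of `A`, for `σ = ±1`. -/
def eVec (n : ℕ) (σ : ℝ) (j : Fin n) : EucV n :=
  EuclideanSpace.single (Sum.inl j) (1 : ℝ) + EuclideanSpace.single (Sum.inr j) σ

open MeasureTheory Set

section Duhamel

variable {V : Type*} [NormedAddCommGroup V] [NormedSpace ℝ V]

/-- The particular solution of `y′ = f - μ y` that is integrated from the base point `T` when
`0 < μ` and from `+∞` when `μ ≤ 0`. -/
def duhamel (μ T : ℝ) (f : ℝ → V) (t : ℝ) : V :=
  exp (-μ * t) • ((∫ s in T..t, exp (μ * s) • f s) -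
    if 0 < μ then 0 else ∫ s in Ioi T, exp (μ * s) • f s)

/-- The weight equal to `1` on `[T, ∞)` and growing like `exp (L (T - t))` on `(-∞, T]`. -/
def expWeight (L T t : ℝ) : ℝ := exp (L * max (T - t) 0)

theorem continuous_expWeight (L T : ℝ) : Continuous (expWeight L T) := by
  unfold expWeight
  fun_prop

theorem expWeight_pos (L T t : ℝ) : 0 < expWeight L T t := exp_pos _

theorem expWeight_of_ge {L T t : ℝ} (h : T ≤ t) : expWeight L T t = 1 := by
  simp [expWeight, max_eq_right (sub_nonpos.2 h)]

theorem expWeight_of_le {L T t : ℝ} (h : t ≤ T) : expWeight L T t = exp (L * (T - t)) := by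
  simp [expWeight, max_eq_left (sub_nonneg.2 h)]

theorem intervalIntegral_exp_mul {c : ℝ} (hc : c ≠ 0) (a b : ℝ) :
    ∫ s in a..b, exp (c * s) = (exp (c * b) - exp (c * a)) / c := by
  have := intervalIntegral.integral_comp_mul_left (a := a) (b := b) (fun s => exp s) hc
  rw [this, integral_exp, smul_eq_mul]
  field_simp

theorem hasDerivAt_duhamel [CompleteSpace V] (μ T : ℝ) {f : ℝ → V} (hf : Continuous f) (t : ℝ) :
    HasDerivAt (duhamel μ T f) (f t - μ • duhamel μ T f t) t := by
  have hc : Continuous fun s => exp (μ * s) • f s := by fun_prop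
  have h1 := (intervalIntegral.integral_hasDerivAt_right (hc.intervalIntegrable T t)
    (hc.stronglyMeasurableAtFilter _ _) hc.continuousAt).sub_const
    (if 0 < μ then 0 else ∫ s in Ioi T, exp (μ * s) • f s)
  have h2 : HasDerivAt (fun t => exp (-μ * t)) (exp (-μ * t) * (-μ * 1)) t :=
    ((hasDerivAt_id t).const_mul (-μ)).exp
  refine (h2.smul h1).congr_deriv ?_
  rw [smul_smul, ← exp_add, neg_mul, neg_add_cancel, exp_zero, one_smul, duhamel, smul_smul,
    sub_eq_add_neg (f t), ← neg_smul]
  congr 2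
  ring_nf

theorem integrableOn_exp_mul_smul {μ T K : ℝ} (hμ : μ ≤ 0) {f : ℝ → V} (hf : Continuous f)
    (hb : ∀ s, T ≤ s → ‖f s‖ ≤ K * exp (-s)) :
    IntegrableOn (fun s => exp (μ * s) • f s) (Ioi T) := by
  have hc : Continuous fun s => exp (μ * s) • f s := by fun_prop
  have hi : IntegrableOn (fun s => K * exp ((μ - 1) * s)) (Ioi T) :=
    (integrableOn_exp_mul_Ioi (by linarith) T).const_mul K
  refine hi.mono' hc.aestronglyMeasurable ?_
  refine (ae_restrict_iff' measurableSet_Ioi).2 (Eventually.of_forall fun s hs => ?_)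
  rw [norm_smul, norm_eq_abs, abs_exp, show (μ - 1) * s = μ * s + -s by ring, exp_add]
  nlinarith [hb s (le_of_lt hs), exp_pos (μ * s)]

theorem duhamel_sub {μ T K K' : ℝ} {f g : ℝ → V} (hf : Continuous f) (hg : Continuous g)
    (hfb : ∀ s, T ≤ s → ‖f s‖ ≤ K * exp (-s)) (hgb : ∀ s, T ≤ s → ‖g s‖ ≤ K' * exp (-s)) (t : ℝ) :
    duhamel μ T (fun s => f s - g s) t = duhamel μ T f t - duhamel μ T g t := by
  have hcf : Continuous fun s => exp (μ * s) • f s := by fun_prop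
  have hcg : Continuous fun s => exp (μ * s) • g s := by fun_prop
  simp only [duhamel, smul_sub]
  rw [intervalIntegral.integral_sub (hcf.intervalIntegrable _ _) (hcg.intervalIntegrable _ _)]
  split_ifs with h
  · simp [smul_sub]
  · rw [integral_sub (integrableOn_exp_mul_smul (not_lt.1 h) hf hfb)
      (integrableOn_exp_mul_smul (not_lt.1 h) hg hgb)]
    simp only [smul_sub]
    abel

theorem norm_duhamel_le_exp_neg {μ T K : ℝ} (hK : 0 ≤ K) (hμ : μ ≤ 0 ∨ 2 ≤ μ) {f : ℝ → V}
    (hf : Continuous f) (hb : ∀ s, T ≤ s → ‖f s‖ ≤ K * exp (-s)) {t : ℝ} (ht : T ≤ t) :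
    ‖duhamel μ T f t‖ ≤ K * exp (-t) := by
  have hpt : ∀ s, T ≤ s → ‖exp (μ * s) • f s‖ ≤ K * exp ((μ - 1) * s) := by
    intro s hs
    rw [norm_smul, norm_eq_abs, abs_exp, show (μ - 1) * s = μ * s + -s by ring, exp_add]
    nlinarith [hb s hs, exp_pos (μ * s)]
  have key : ‖(∫ s in T..t, exp (μ * s) • f s) -
      if 0 < μ then 0 else ∫ s in Ioi T, exp (μ * s) • f s‖ ≤ K * exp ((μ - 1) * t) := by
    split_ifs with h
    · have hμ2 : 2 ≤ μ := hμ.resolve_left (not_le.2 h)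
      rw [sub_zero]
      refine (intervalIntegral.norm_integral_le_of_norm_le (g := fun s => K * exp ((μ - 1) * s)) ht
        (Eventually.of_forall fun s hs => hpt s hs.1.le)
        (Continuous.intervalIntegrable (by fun_prop) _ _)).trans ?_
      rw [intervalIntegral.integral_const_mul, intervalIntegral_exp_mul (by linarith)]
      gcongr
      rw [div_le_iff₀ (by linarith)]
      nlinarith [exp_pos ((μ - 1) * t), exp_pos ((μ - 1) * T)]
    · have hμ0 := not_lt.1 h
      have hi := integrableOn_exp_mul_smul hμ0 hf hb
      rw [← intervalIntegral.integral_interval_add_Ioi hi (hi.mono_set (Ioi_subset_Ioi ht)),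
        sub_add_cancel_left, norm_neg]
      refine (norm_integral_le_of_norm_le
        ((integrableOn_exp_mul_Ioi (by linarith : μ - 1 < 0) t).const_mul K)
        ((ae_restrict_iff' measurableSet_Ioi).2
          (Eventually.of_forall fun s hs => hpt s (ht.trans (le_of_lt hs))))).trans ?_
      rw [integral_const_mul, integral_exp_mul_Ioi (by linarith)]
      gcongr
      rw [div_le_iff_of_neg (by linarith)]
      nlinarith [exp_pos ((μ - 1) * t)]
  rw [duhamel, norm_smul, norm_eq_abs, abs_exp]
  calc exp (-μ * t) * _ ≤ exp (-μ * t) * (K * exp ((μ - 1) * t)) := by gcongr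
    _ = K * exp (-t) := by
      rw [mul_left_comm, ← exp_add]
      ring_nf

theorem norm_duhamel_le_expWeight {μ L T K : ℝ} (hK : 0 ≤ K) (hμ : μ ≤ 0 ∨ 2 ≤ μ) (hμL : μ < L)
    (hT : 0 ≤ T) {f : ℝ → V} (hf : Continuous f)
    (hb : ∀ s, ‖f s‖ ≤ K * (exp (-|s|) * expWeight L T s)) (t : ℝ) :
    ‖duhamel μ T f t‖ ≤ K * (exp (-T) + 1 / (L - μ)) * expWeight L T t := by
  have hb' : ∀ s, T ≤ s → ‖f s‖ ≤ K * exp (-s) := fun s hs => by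
    simpa [expWeight_of_ge hs, abs_of_nonneg (hT.trans hs)] using hb s
  have hLμ : 0 < L - μ := sub_pos.2 hμL
  rcases le_total T t with ht | ht
  · rw [expWeight_of_ge ht, mul_one]
    refine (norm_duhamel_le_exp_neg hK hμ hf hb' ht).trans ?_
    gcongr
    have : exp (-t) ≤ exp (-T) := by gcongr
    have := one_div_pos.2 hLμ
    linarith
  · have hc : Continuous fun s => exp (μ * s) • f s := by fun_prop
    have hdec : duhamel μ T f t =
        exp (μ * (T - t)) • duhamel μ T f T - exp (-μ * t) • ∫ s in t..T, exp (μ * s) • f s := by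
      simp only [duhamel, intervalIntegral.integral_same, smul_smul, ← exp_add]
      rw [intervalIntegral.integral_symm t T, show μ * (T - t) + -μ * T = -μ * t by ring,
        ← smul_sub]
      congr 1
      abel
    have hpt : ∀ s ∈ Ioc t T, ‖exp (μ * s) • f s‖ ≤ K * exp (L * T) * exp ((μ - L) * s) := by
      intro s hs
      have h1 := hb s
      rw [expWeight_of_le hs.2] at h1
      have h2 : exp (-|s|) ≤ 1 := exp_le_one_iff.2 (neg_nonpos.2 (abs_nonneg s))
      rw [norm_smul, norm_eq_abs, abs_exp]
      calc exp (μ * s) * ‖f s‖ ≤ exp (μ * s) * (K * (1 * exp (L * (T - s)))) := by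
            gcongr
            exact h1.trans (by gcongr)
        _ = K * (exp (μ * s) * exp (L * (T - s))) := by ring
        _ = K * (exp (L * T) * exp ((μ - L) * s)) := by
            rw [← exp_add, ← exp_add]
            ring_nf
        _ = _ := by ring
    have hint : ‖∫ s in t..T, exp (μ * s) • f s‖ ≤
        K * exp (L * T) * (exp ((μ - L) * t) / (L - μ)) := by
      refine (intervalIntegral.norm_integral_le_of_norm_le
        (g := fun s => K * exp (L * T) * exp ((μ - L) * s)) ht (Eventually.of_forall hpt)
        (Continuous.intervalIntegrable (by fun_prop) _ _)).trans ?_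
      rw [intervalIntegral.integral_const_mul, intervalIntegral_exp_mul (by linarith)]
      refine mul_le_mul_of_nonneg_left ?_ (by positivity)
      rw [← neg_div_neg_eq, neg_sub, neg_sub]
      gcongr
      linarith [exp_pos ((μ - L) * T)]
    rw [hdec, expWeight_of_le ht]
    refine (norm_sub_le _ _).trans ?_
    rw [norm_smul, norm_smul, norm_eq_abs, norm_eq_abs, abs_exp, abs_exp]
    have h1 := norm_duhamel_le_exp_neg hK hμ hf hb' le_rfl
    calc _ ≤ exp (L * (T - t)) * (K * exp (-T)) +
          exp (-μ * t) * (K * exp (L * T) * (exp ((μ - L) * t) / (L - μ))) := by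
          gcongr
      _ = exp (L * (T - t)) * (K * exp (-T)) +
          K / (L - μ) * (exp (-μ * t) * exp (L * T) * exp ((μ - L) * t)) := by ring
      _ = exp (L * (T - t)) * (K * exp (-T)) + K / (L - μ) * exp (L * (T - t)) := by
          rw [← exp_add, ← exp_add]
          ring_nf
      _ = _ := by ring

end Duhamel

section Asymptotic

variable {V : Type*} [NormedAddCommGroup V] [NormedSpace ℝ V] [CompleteSpace V]

open scoped BoundedContinuousFunction

/-- A variation-of-constants equation with exponentially decaying coefficient has a global
solution, of growth controlled by `expWeight`. -/
theorem exists_eq_add_duhamel {E : ℝ → V →L[ℝ] V} (hE : Continuous E) {C : ℝ} (hC : 0 < C)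
    (hEb : ∀ t, ‖E t‖ ≤ C * exp (-|t|)) {μ : ℝ} (hμ : μ ≤ 0 ∨ 2 ≤ μ) (R Q : V →L[ℝ] V) (e : V) :
    ∃ (T K : ℝ) (y : ℝ → V), 0 ≤ T ∧ 0 ≤ K ∧ Continuous y ∧
      (∀ t, T ≤ t → ‖E t (y t)‖ ≤ K * exp (-t)) ∧
      ∀ t, y t = e + R (duhamel 0 T (fun s => E s (y s)) t) +
        Q (duhamel μ T (fun s => E s (y s)) t) := by
  set D : ℝ := (‖R‖ + ‖Q‖ + 1) * C with hD
  have hD0 : 0 < D := by positivity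
  obtain ⟨T, hT, hTD⟩ : ∃ T : ℝ, 0 ≤ T ∧ exp (-T) ≤ 1 / (8 * D) := by
    refine ⟨max 0 (log (8 * D)), le_max_left _ _, ?_⟩
    rw [exp_neg, one_div]
    refine inv_anti₀ (by positivity) ?_
    exact (exp_log (by positivity : (0 : ℝ) < 8 * D)).symm.le.trans (exp_le_exp.2 (le_max_right _ _))
  set L : ℝ := |μ| + 8 * D with hL
  have hL0 : 8 * D ≤ L - 0 := by linarith [abs_nonneg μ]
  have hLμ : 8 * D ≤ L - μ := by linarith [le_abs_self μ]
  let w := expWeight L T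
  have hw0 : ∀ t, 0 < w t := expWeight_pos L T
  have hwc : Continuous w := continuous_expWeight L T
  let g : (ℝ →ᵇ V) → ℝ → V := fun u s => E s (w s • u s)
  have hgc : ∀ u, Continuous (g u) := fun u => hE.clm_apply (hwc.smul u.continuous)
  have hgb : ∀ u s, ‖g u s‖ ≤ C * ‖u‖ * (exp (-|s|) * w s) := by
    intro u s
    calc ‖g u s‖ ≤ ‖E s‖ * ‖w s • u s‖ := (E s).le_opNorm _
      _ ≤ (C * exp (-|s|)) * (w s * ‖u‖) := by
        rw [norm_smul, norm_of_nonneg (hw0 s).le]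
        have := (hw0 s).le
        gcongr
        · exact hEb s
        · exact u.norm_coe_le_norm s
      _ = _ := by ring
  have hgb' : ∀ u s, T ≤ s → ‖g u s‖ ≤ C * ‖u‖ * exp (-s) := fun u s hs => by
    simpa [w, expWeight_of_ge hs, abs_of_nonneg (hT.trans hs)] using hgb u s
  let P : (ℝ →ᵇ V) → ℝ → V := fun u t => R (duhamel 0 T (g u) t) + Q (duhamel μ T (g u) t)
  have hdc : ∀ ν u, Continuous (duhamel ν T (g u)) := fun ν u =>
    continuous_iff_continuousAt.2 fun t => (hasDerivAt_duhamel ν T (hgc u) t).continuousAt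
  have hPc : ∀ u, Continuous (P u) := fun u =>
    (R.continuous.comp (hdc 0 u)).add (Q.continuous.comp (hdc μ u))
  have hdb : ∀ ν, (ν ≤ 0 ∨ 2 ≤ ν) → 8 * D ≤ L - ν → ∀ u t,
      ‖duhamel ν T (g u) t‖ ≤ C * ‖u‖ * (1 / (4 * D)) * w t := by
    intro ν hν hLν u t
    refine (norm_duhamel_le_expWeight (L := L) (by positivity) hν (by linarith) hT
      (hgc u) (hgb u) t).trans ?_
    have h1 : 1 / (L - ν) ≤ 1 / (8 * D) := by gcongr
    have h2 : (1 : ℝ) / (4 * D) = 1 / (8 * D) + 1 / (8 * D) := by field_simp; norm_num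
    have := (hw0 t).le
    rw [h2]
    gcongr
  have hPb : ∀ u t, ‖P u t‖ ≤ 1 / 4 * ‖u‖ * w t := by
    intro u t
    have := (hw0 t).le
    calc ‖P u t‖ ≤ ‖R‖ * ‖duhamel 0 T (g u) t‖ + ‖Q‖ * ‖duhamel μ T (g u) t‖ :=
          (norm_add_le _ _).trans (add_le_add (R.le_opNorm _) (Q.le_opNorm _))
      _ ≤ ‖R‖ * (C * ‖u‖ * (1 / (4 * D)) * w t) + ‖Q‖ * (C * ‖u‖ * (1 / (4 * D)) * w t) := by
          gcongr
          · exact hdb 0 (Or.inl le_rfl) hL0 u t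
          · exact hdb μ hμ hLμ u t
      _ = ((‖R‖ + ‖Q‖) * C) * (1 / (4 * D)) * (‖u‖ * w t) := by ring
      _ ≤ D * (1 / (4 * D)) * (‖u‖ * w t) := by
          gcongr
          exact mul_le_mul_of_nonneg_right (by linarith) hC.le
      _ = _ := by field_simp
  have hPsub : ∀ u v t, P u t - P v t = P (u - v) t := by
    intro u v t
    have hg : g (u - v) = fun s => g u s - g v s := by
      funext s
      simp [g, smul_sub]
    simp only [P, hg]
    rw [duhamel_sub (hgc u) (hgc v) (hgb' u) (hgb' v), duhamel_sub (hgc u) (hgc v) (hgb' u) (hgb' v)]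
    simp only [map_sub]
    abel
  have hw1 : ∀ t, 1 ≤ w t := fun t =>
    one_le_exp (mul_nonneg (by positivity) (le_max_right _ _))
  let Φ : (ℝ →ᵇ V) → (ℝ →ᵇ V) := fun u =>
    BoundedContinuousFunction.ofNormedAddCommGroup (fun t => (w t)⁻¹ • (e + P u t))
      ((hwc.inv₀ fun t => (hw0 t).ne').smul (continuous_const.add (hPc u)))
      (‖e‖ + 1 / 4 * ‖u‖) (fun t => by
        rw [norm_smul, norm_inv, norm_of_nonneg (hw0 t).le, inv_mul_le_iff₀ (hw0 t)]
        refine (norm_add_le _ _).trans ?_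
        nlinarith [hPb u t, norm_nonneg e, hw1 t])
  have hΦ : ContractingWith (1 / 4) Φ := by
    refine ⟨by rw [← NNReal.coe_lt_coe]; norm_num, LipschitzWith.of_dist_le_mul fun u v => ?_⟩
    rw [BoundedContinuousFunction.dist_le (by positivity)]
    intro t
    have hdiff : Φ u t - Φ v t = (w t)⁻¹ • P (u - v) t := by
      simp only [Φ, BoundedContinuousFunction.coe_ofNormedAddCommGroup]
      rw [← smul_sub, add_sub_add_left_eq_sub, hPsub]
    rw [dist_eq_norm, hdiff, norm_smul, norm_inv, norm_of_nonneg (hw0 t).le,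
      inv_mul_le_iff₀ (hw0 t), dist_eq_norm]
    refine (hPb (u - v) t).trans (le_of_eq ?_)
    push_cast
    ring
  have hfix := hΦ.fixedPoint_isFixedPt
  set u := hΦ.fixedPoint Φ
  refine ⟨T, C * ‖u‖, fun t => w t • u t, hT, by positivity, hwc.smul u.continuous, hgb' u,
    fun t => ?_⟩
  have h : (w t)⁻¹ • (e + P u t) = u t := DFunLike.congr_fun hfix t
  rw [inv_smul_eq_iff₀ (hw0 t).ne'] at h
  rw [add_assoc]
  exact h.symm

/-- If `A` is an involution with `A e = σ e`, `σ = ±1`, then the exponentially decaying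
perturbation `x′ = (A + E(t)) x` has a solution asymptotic to `exp (σ t) • e` at `+∞`. -/
theorem exists_hasDerivAt_tendsto_of_involution (A : V →L[ℝ] V) (hA : ∀ v, A (A v) = v)
    {E : ℝ → V →L[ℝ] V} (hE : Continuous E) {C : ℝ} (hC : 0 < C)
    (hEb : ∀ t, ‖E t‖ ≤ C * exp (-|t|)) {σ : ℝ} (hσ : σ = 1 ∨ σ = -1) {e : V} (he : A e = σ • e) :
    ∃ x : ℝ → V, (∀ t, HasDerivAt x (A (x t) + E t (x t)) t) ∧
      Tendsto (fun t => exp (-σ * t) • x t) atTop (𝓝 e) := by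
  have hσ2 : σ * σ = 1 := by rcases hσ with rfl | rfl <;> norm_num
  have hμ : 2 * σ ≤ 0 ∨ 2 ≤ 2 * σ := by rcases hσ with rfl | rfl <;> norm_num
  let R : V →L[ℝ] V := (1 / 2 : ℝ) • (ContinuousLinearMap.id ℝ V + σ • A)
  let Q : V →L[ℝ] V := (1 / 2 : ℝ) • (ContinuousLinearMap.id ℝ V - σ • A)
  have hRQ : ∀ v, R v + Q v = v := fun v => by
    simp only [R, Q, FunLike.coe_smul, Pi.smul_apply, add_apply,
      sub_apply, ContinuousLinearMap.id_apply]
    module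
  have hAR : ∀ v, A (R v) = σ • R v := fun v => by
    simp only [R, FunLike.coe_smul, Pi.smul_apply, add_apply,
      ContinuousLinearMap.id_apply, map_smul, map_add, hA, smul_add, smul_smul]
    rw [show σ * (1 / 2 * σ) = 1 / 2 by linear_combination hσ2 / 2]
    module
  have hAQ : ∀ v, A (Q v) = -σ • Q v := fun v => by
    simp only [Q, FunLike.coe_smul, Pi.smul_apply, sub_apply,
      ContinuousLinearMap.id_apply, map_smul, map_sub, hA, smul_sub, smul_smul]
    rw [show -σ * (1 / 2 * σ) = -(1 / 2) by linear_combination -hσ2 / 2]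
    module
  obtain ⟨T, K, y, hT, hK, hyc, hyb, hy⟩ := exists_eq_add_duhamel hE hC hEb hμ R Q e
  have hgc : Continuous fun s => E s (y s) := hE.clm_apply hyc
  have hyd : ∀ t, HasDerivAt y (A (y t) - σ • y t + E t (y t)) t := by
    intro t
    have h1 := R.hasFDerivAt.comp_hasDerivAt t (hasDerivAt_duhamel 0 T hgc t)
    have h2 := Q.hasFDerivAt.comp_hasDerivAt t (hasDerivAt_duhamel (2 * σ) T hgc t)
    have h3 := (h1.const_add e).add h2
    refine (h3.congr_of_eventuallyEq (Eventually.of_forall hy)).congr_deriv ?_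
    have hAy : A (y t) - σ • y t = -(2 * σ) • Q (duhamel (2 * σ) T (fun s => E s (y s)) t) := by
      rw [hy t]
      simp only [map_add, hAR, hAQ, he]
      module
    rw [hAy]
    nth_rewrite 3 [← hRQ (E t (y t))]
    simp only [map_sub, map_smul, zero_smul, sub_zero]
    module
  have hdt : ∀ μ : ℝ, (μ ≤ 0 ∨ 2 ≤ μ) →
      Tendsto (duhamel μ T fun s => E s (y s)) atTop (𝓝 0) := by
    intro μ hμ
    refine squeeze_zero_norm' (a := fun t => K * exp (-t)) ?_ ?_
    · filter_upwards [eventually_ge_atTop T] with t ht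
      exact norm_duhamel_le_exp_neg hK hμ hgc hyb ht
    · simpa using (tendsto_exp_neg_atTop_nhds_zero.const_mul K)
  refine ⟨fun t => exp (σ * t) • y t, fun t => ?_, ?_⟩
  · have h1 : HasDerivAt (fun t => exp (σ * t)) (exp (σ * t) * (σ * 1)) t :=
      ((hasDerivAt_id t).const_mul σ).exp
    refine (h1.smul (hyd t)).congr_deriv ?_
    simp only [map_smul]
    module
  · have hlim : Tendsto (fun t => e + R (duhamel 0 T (fun s => E s (y s)) t) +
        Q (duhamel (2 * σ) T (fun s => E s (y s)) t)) atTop (𝓝 (e + R 0 + Q 0)) :=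
      (tendsto_const_nhds.add ((R.continuous.tendsto 0).comp (hdt 0 (Or.inl le_rfl)))).add
        ((Q.continuous.tendsto 0).comp (hdt (2 * σ) hμ))
    simp only [map_zero, add_zero] at hlim
    refine hlim.congr fun t => ?_
    rw [smul_smul, ← exp_add, neg_mul, neg_add_cancel, exp_zero, one_smul, ← hy t]

end Asymptotic

theorem Amap_apply (n : ℕ) (v : EucV n) (i : Fin n ⊕ Fin n) : Amap n v i = v i.swap := rfl

theorem Amap_eVec (n : ℕ) {σ : ℝ} (hσ : σ = 1 ∨ σ = -1) (j : Fin n) :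
    Amap n (eVec n σ j) = σ • eVec n σ j := by
  have hσ2 : σ * σ = 1 := by rcases hσ with rfl | rfl <;> norm_num
  ext i
  rw [Amap_apply]
  rcases i with i | i <;> simp [eVec, hσ2]

/-- For each sign `σ = ±1` and each `1 ≤ j ≤ n`, there is a solution of the perturbed
system `x′ = (A + E(t)) x` with `e^{-σ t} x(t) → e_j^σ` as `t → +∞`. -/
theorem exists_solution_asymptotic_to_eigenvector
    (n : ℕ) (hn : 1 ≤ n)
    (E : ℝ → (EucV n →L[ℝ] EucV n)) (hE : Continuous E)
    (C₀ : ℝ) (hC₀ : 0 < C₀)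
    (hEb : ∀ t : ℝ, ‖E t‖ ≤ C₀ * Real.exp (-|t|))
    (σ : ℝ) (hσ : σ = 1 ∨ σ = -1) (j : Fin n) :
    ∃ x : ℝ → EucV n, IsSol n E x ∧
      Tendsto (fun t : ℝ => Real.exp (-σ * t) • x t) atTop (𝓝 (eVec n σ j)) :=
  exists_hasDerivAt_tendsto_of_involution (Amap n)
    (fun v => by ext i; simp [Amap_apply]) hE hC₀ hEb hσ (Amap_eVec n hσ j)

end
end

section
/- For every real λ > 0 the function θ ↦ (sin θ)^{λ−1} is integrable on (0, π), and lim_{λ→0⁺} ( ∫₀^π (sin θ)^{λ−1} dθ − 2/λ ) = 2·log 2. -/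
open Real Filter Topology MeasureTheory

lemma one_sub_cos_eq_sin_mul_tan_half {x : ℝ} (hx : cos (x / 2) ≠ 0) :
    1 - cos x = sin x * tan (x / 2) := by
  obtain ⟨y, rfl⟩ : ∃ y, x = 2 * y := ⟨x / 2, by ring⟩
  rw [mul_div_cancel_left₀ y two_ne_zero] at hx ⊢
  rw [cos_two_mul, sin_two_mul, tan_eq_sin_div_cos]
  field_simp
  linear_combination -2 * sin_sq_add_cos_sq y

lemma cos_half_pos_of_mem_Icc {x : ℝ} (hx : x ∈ Set.Icc 0 (π / 2)) : 0 < cos (x / 2) :=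
  cos_pos_of_mem_Ioo ⟨by linarith [hx.1, pi_pos], by linarith [hx.2, pi_pos]⟩

lemma continuousOn_tan_half : ContinuousOn (fun x : ℝ => tan (x / 2)) (Set.Icc 0 (π / 2)) := by
  simp only [tan_eq_sin_div_cos]
  exact ContinuousOn.div (by fun_prop) (by fun_prop) fun x hx => (cos_half_pos_of_mem_Icc hx).ne'

lemma intervalIntegrable_tan_half :
    IntervalIntegrable (fun x : ℝ => tan (x / 2)) volume 0 (π / 2) := by
  apply ContinuousOn.intervalIntegrable
  rw [Set.uIcc_of_le (by positivity)]
  exact continuousOn_tan_half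

lemma integral_tan_half : ∫ x in (0 : ℝ)..(π / 2), tan (x / 2) = log 2 := by
  have hderiv : ∀ x ∈ Set.uIcc (0 : ℝ) (π / 2),
      HasDerivAt (fun x => -2 * log (cos (x / 2))) (tan (x / 2)) x := by
    intro x hx
    rw [Set.uIcc_of_le (by positivity)] at hx
    have hc := (cos_half_pos_of_mem_Icc hx).ne'
    refine ((((hasDerivAt_id x).div_const 2).cos.log hc).const_mul (-2)).congr_deriv ?_
    simp only [tan_eq_sin_div_cos, id]
    field_simp
  rw [intervalIntegral.integral_eq_sub_of_hasDerivAt hderiv intervalIntegrable_tan_half,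
    show π / 2 / 2 = π / 4 by ring, cos_pi_div_four, log_div (by positivity) two_ne_zero,
    log_sqrt zero_le_two]
  simp
  ring

lemma hasDerivAt_sin_rpow_div {l x : ℝ} (hl : l ≠ 0) (hx : sin x ≠ 0) :
    HasDerivAt (fun x => sin x ^ l / l) (sin x ^ (l - 1) * cos x) x := by
  refine (((hasDerivAt_sin x).rpow_const (p := l) (Or.inl hx)).div_const l).congr_deriv ?_
  field_simp

lemma sin_pos_of_mem_Ioc {x : ℝ} (hx : x ∈ Set.Ioc 0 (π / 2)) : 0 < sin x :=
  sin_pos_of_pos_of_lt_pi hx.1 (by linarith [hx.2, pi_pos])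

lemma continuous_sin_rpow_div {l : ℝ} (hl : 0 < l) : Continuous fun x => sin x ^ l / l :=
  (continuous_sin.rpow_const fun _ => Or.inr hl.le).div_const l

lemma intervalIntegrable_sin_rpow_mul_cos {l : ℝ} (hl : 0 < l) :
    IntervalIntegrable (fun x => sin x ^ (l - 1) * cos x) volume 0 (π / 2) := by
  rw [intervalIntegrable_iff_integrableOn_Ioc_of_le (by positivity)]
  refine intervalIntegral.integrableOn_deriv_of_nonneg (continuous_sin_rpow_div hl).continuousOn
    (fun x hx => hasDerivAt_sin_rpow_div hl.ne' (sin_pos_of_mem_Ioc ⟨hx.1, hx.2.le⟩).ne')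
    fun x hx => ?_
  exact mul_nonneg (rpow_nonneg (sin_pos_of_mem_Ioc ⟨hx.1, hx.2.le⟩).le _)
    (cos_nonneg_of_mem_Icc ⟨by linarith [hx.1, pi_pos], hx.2.le⟩)

lemma integral_sin_rpow_mul_cos {l : ℝ} (hl : 0 < l) :
    ∫ x in (0 : ℝ)..(π / 2), sin x ^ (l - 1) * cos x = 1 / l := by
  rw [intervalIntegral.integral_eq_sub_of_hasDerivAt_of_le (by positivity)
    (continuous_sin_rpow_div hl).continuousOn
    (fun x hx => hasDerivAt_sin_rpow_div hl.ne' (sin_pos_of_mem_Ioc ⟨hx.1, hx.2.le⟩).ne')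
    (intervalIntegrable_sin_rpow_mul_cos hl)]
  simp [zero_rpow hl.ne']

lemma sin_rpow_mul_one_sub_cos {l x : ℝ} (hx : x ∈ Set.Ioc 0 (π / 2)) :
    sin x ^ (l - 1) * (1 - cos x) = sin x ^ l * tan (x / 2) := by
  have hs := sin_pos_of_mem_Ioc hx
  rw [one_sub_cos_eq_sin_mul_tan_half (cos_half_pos_of_mem_Icc ⟨hx.1.le, hx.2⟩).ne',
    rpow_sub_one hs.ne']
  field_simp

lemma norm_sin_rpow_mul_one_sub_cos_le {l x : ℝ} (hl : 0 < l) (hx : x ∈ Set.Ioc 0 (π / 2)) :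
    ‖sin x ^ (l - 1) * (1 - cos x)‖ ≤ tan (x / 2) := by
  have hs := sin_pos_of_mem_Ioc hx
  have ht : 0 ≤ tan (x / 2) :=
    tan_nonneg_of_nonneg_of_le_pi_div_two (by linarith [hx.1]) (by linarith [hx.1, hx.2])
  rw [sin_rpow_mul_one_sub_cos hx, norm_of_nonneg (mul_nonneg (rpow_nonneg hs.le l) ht)]
  exact mul_le_of_le_one_left ht (rpow_le_one hs.le (sin_le_one x) hl.le)

lemma measurable_sin_rpow_mul_one_sub_cos (l : ℝ) :
    Measurable fun x => sin x ^ (l - 1) * (1 - cos x) := by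
  fun_prop

lemma intervalIntegrable_sin_rpow_mul_one_sub_cos {l : ℝ} (hl : 0 < l) :
    IntervalIntegrable (fun x => sin x ^ (l - 1) * (1 - cos x)) volume 0 (π / 2) := by
  refine intervalIntegrable_tan_half.mono_fun'
    (measurable_sin_rpow_mul_one_sub_cos l).aestronglyMeasurable ?_
  rw [Set.uIoc_of_le (by positivity)]
  filter_upwards [ae_restrict_mem measurableSet_Ioc] with x hx
  exact norm_sin_rpow_mul_one_sub_cos_le hl hx

lemma tendsto_integral_sin_rpow_mul_one_sub_cos :
    Tendsto (fun l : ℝ => ∫ x in (0 : ℝ)..(π / 2), sin x ^ (l - 1) * (1 - cos x))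
      (𝓝[>] (0 : ℝ)) (𝓝 (log 2)) := by
  rw [← integral_tan_half]
  refine intervalIntegral.tendsto_integral_filter_of_dominated_convergence
    (fun x => tan (x / 2))
    (.of_forall fun l => (measurable_sin_rpow_mul_one_sub_cos l).aestronglyMeasurable) ?_
    intervalIntegrable_tan_half ?_
  · filter_upwards [self_mem_nhdsWithin] with l hl
    refine .of_forall fun x hx => norm_sin_rpow_mul_one_sub_cos_le hl ?_
    rwa [Set.uIoc_of_le (by positivity)] at hx
  · refine .of_forall fun x hx => ?_
    rw [Set.uIoc_of_le (by positivity)] at hx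
    simp only [sin_rpow_mul_one_sub_cos hx]
    have h : Tendsto (fun l : ℝ => sin x ^ l * tan (x / 2)) (𝓝 0)
        (𝓝 (sin x ^ (0 : ℝ) * tan (x / 2))) :=
      (continuousAt_const_rpow (sin_pos_of_mem_Ioc hx).ne').tendsto.mul_const _
    rw [rpow_zero, one_mul] at h
    exact h.mono_left nhdsWithin_le_nhds

lemma intervalIntegrable_sin_rpow_zero_pi_div_two {l : ℝ} (hl : 0 < l) :
    IntervalIntegrable (fun x => sin x ^ (l - 1)) volume 0 (π / 2) := by
  refine ((intervalIntegrable_sin_rpow_mul_cos hl).add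
    (intervalIntegrable_sin_rpow_mul_one_sub_cos hl)).congr fun x _ => ?_
  ring

lemma intervalIntegrable_sin_rpow_pi_div_two_pi {l : ℝ} (hl : 0 < l) :
    IntervalIntegrable (fun x => sin x ^ (l - 1)) volume (π / 2) π := by
  have h := (intervalIntegrable_sin_rpow_zero_pi_div_two hl).comp_sub_left π
  simp only [sin_pi_sub, sub_zero, sub_half] at h
  exact h.symm

lemma integral_sin_rpow_zero_pi {l : ℝ} (hl : 0 < l) :
    ∫ x in (0 : ℝ)..π, sin x ^ (l - 1) =
      2 * (1 / l + ∫ x in (0 : ℝ)..(π / 2), sin x ^ (l - 1) * (1 - cos x)) := by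
  have hrefl : ∫ x in (π / 2)..π, sin x ^ (l - 1) = ∫ x in (0 : ℝ)..(π / 2), sin x ^ (l - 1) := by
    have h := intervalIntegral.integral_comp_sub_left (a := 0) (b := π / 2)
      (fun x => sin x ^ (l - 1)) π
    simp only [sin_pi_sub, sub_zero, sub_half] at h
    exact h.symm
  rw [← intervalIntegral.integral_add_adjacent_intervals
    (intervalIntegrable_sin_rpow_zero_pi_div_two hl) (intervalIntegrable_sin_rpow_pi_div_two_pi hl),
    hrefl, ← two_mul, ← integral_sin_rpow_mul_cos hl, ← intervalIntegral.integral_add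
    (intervalIntegrable_sin_rpow_mul_cos hl) (intervalIntegrable_sin_rpow_mul_one_sub_cos hl)]
  congr 2 with x
  ring

/-- For `λ > 0` the function `θ ↦ (sin θ)^{λ−1}` is integrable on `(0,π)`, and the finite
part at `λ = 0`: `∫₀^π (sin θ)^{λ−1} dθ − 2/λ → 2 log 2` as `λ → 0⁺`. -/
theorem sin_rpow_integral_finite_part :
    (∀ l : ℝ, 0 < l →
      IntegrableOn (fun θ : ℝ => Real.sin θ ^ (l - 1)) (Set.Ioo 0 π)) ∧
    Tendsto (fun l : ℝ => (∫ θ in Set.Ioo (0:ℝ) π, Real.sin θ ^ (l - 1)) - 2 / l)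
      (𝓝[>] (0:ℝ)) (𝓝 (2 * Real.log 2)) := by
  refine ⟨fun l hl => ?_, ?_⟩
  · rw [← intervalIntegrable_iff_integrableOn_Ioo_of_le pi_pos.le]
    exact (intervalIntegrable_sin_rpow_zero_pi_div_two hl).trans
      (intervalIntegrable_sin_rpow_pi_div_two_pi hl)
  · refine (tendsto_integral_sin_rpow_mul_one_sub_cos.const_mul 2).congr' ?_
    filter_upwards [self_mem_nhdsWithin] with l hl
    rw [← integral_Ioc_eq_integral_Ioo, ← intervalIntegral.integral_of_le pi_pos.le,
      integral_sin_rpow_zero_pi hl]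
    ring
end

section
/- Let f : [0,1] × [0,π] → ℝ be smooth (all partial derivatives extend continuously to the closed rectangle) and suppose f(0,θ) = 0 for every θ ∈ [0,π]. Then lim_{λ→0⁺} ∫₀^π (sin θ)^{λ−1}·f(λ,θ) dθ = ∂_λ f(0,0) + ∂_λ f(0,π), where ∂_λ f denotes the partial derivative of f in its first variable. -/
open Real Filter Topology MeasureTheory

/-- A `C²` function of two variables which vanishes for first variable `0` is Lipschitz in the
second variable, with a constant proportional to the first variable. -/
theorem exists_abs_sub_le_mul_of_contDiff {E : ℝ → ℝ → ℝ} {a b : ℝ}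
    (hE : ContDiff ℝ 2 (fun p : ℝ × ℝ => E p.1 p.2)) (hE0 : ∀ θ ∈ Set.Icc a b, E 0 θ = 0) :
    ∃ K : ℝ, 0 ≤ K ∧ ∀ l ∈ Set.Icc (0:ℝ) 1, ∀ θ ∈ Set.Icc a b, ∀ τ ∈ Set.Icc a b,
      |E l θ - E l τ| ≤ K * |θ - τ| * l := by
  set F : ℝ × ℝ → ℝ := fun p => E p.1 p.2
  have hp : ContDiff ℝ 1 (fun x => fderiv ℝ F x ((1:ℝ), (0:ℝ))) :=
    (hE.fderiv_right (by norm_num)).clm_apply contDiff_const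
  obtain ⟨K, hK⟩ := (hp.contDiffOn (s := Set.Icc (0:ℝ) 1 ×ˢ Set.Icc a b)).exists_lipschitzOnWith
    one_ne_zero ((convex_Icc _ _).prod (convex_Icc _ _)) (isCompact_Icc.prod isCompact_Icc)
  have hder (θ l : ℝ) :
      HasDerivAt (fun l => E l θ) (fderiv ℝ F (l, θ) ((1:ℝ), (0:ℝ))) l :=
    (hE.differentiable (by norm_num) (l, θ)).hasFDerivAt.comp_hasDerivAt (f := fun l => (l, θ)) l
      ((hasDerivAt_id' l).prodMk (hasDerivAt_const l θ))
  refine ⟨K, K.2, fun l hl θ hθ τ hτ => ?_⟩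
  have h := Convex.norm_image_sub_le_of_norm_hasDerivWithin_le (C := K * |θ - τ|)
    (fun x (_ : x ∈ Set.Icc (0:ℝ) 1) => ((hder θ x).sub (hder τ x)).hasDerivWithinAt)
    (fun x hx => by
      have h := hK.dist_le_mul (x, θ) ⟨hx, hθ⟩ (x, τ) ⟨hx, hτ⟩
      simpa [Prod.dist_eq, Real.dist_eq] using h)
    (convex_Icc _ _) (Set.left_mem_Icc.2 zero_le_one) hl
  simpa [hE0 θ hθ, hE0 τ hτ, abs_of_nonneg hl.1] using h

theorem le_pi_div_two_mul_sin {θ : ℝ} (h0 : 0 ≤ θ) (h1 : θ ≤ π / 2) : θ ≤ π / 2 * sin θ := by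
  have h := mul_le_mul_of_nonneg_left (mul_le_sin h0 h1) pi_div_two_pos.le
  have e : π / 2 * (2 / π * θ) = θ := by field_simp
  linarith

theorem intervalIntegrable_sin_rpow_sub_one {l : ℝ} (hl : 0 < l) :
    IntervalIntegrable (fun θ => sin θ ^ (l - 1)) volume 0 π := by
  have hc (p : ℝ) (hp : 0 < p) : Continuous fun θ => sin θ ^ p :=
    continuous_sin.rpow_const fun _ => Or.inr hp.le
  have h : IntervalIntegrable (fun θ => cos θ * l * sin θ ^ (l - 1) * cos θ
      + sin θ ^ l * (-sin θ) + 1) volume 0 π := by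
    refine intervalIntegral.intervalIntegrable_deriv_of_nonneg
      (g := fun θ => sin θ ^ l * cos θ + θ) ?_ ?_ ?_
    · exact (((hc l hl).mul continuous_cos).add continuous_id).continuousOn
    · intro θ hθ
      rw [min_eq_left pi_pos.le, max_eq_right pi_pos.le] at hθ
      have hs := sin_pos_of_mem_Ioo hθ
      exact (((hasDerivAt_sin θ).rpow_const (Or.inl hs.ne')).mul (hasDerivAt_cos θ)).add
        (hasDerivAt_id θ)
    · intro θ hθ
      rw [min_eq_left pi_pos.le, max_eq_right pi_pos.le] at hθ
      have hs := sin_pos_of_mem_Ioo hθ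
      have h1 : sin θ ^ l ≤ 1 := rpow_le_one hs.le (sin_le_one θ) hl.le
      have h2 : 0 ≤ l * sin θ ^ (l - 1) * (cos θ * cos θ) := by
        have := mul_self_nonneg (cos θ)
        positivity
      have h3 : sin θ ^ l * sin θ ≤ 1 := mul_le_one₀ h1 hs.le (sin_le_one θ)
      linarith
  have h2 := ((h.sub (g := fun _ => (1:ℝ)) (by simp)).add
    ((((hc l hl).mul continuous_sin).intervalIntegrable 0 π).const_mul (1 + l))).const_mul l⁻¹
  refine h2.congr_uIoo fun θ hθ => ?_
  rw [Set.uIoo_of_le pi_pos.le] at hθ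
  have hs := sin_pos_of_mem_Ioo hθ
  have e : sin θ ^ l = sin θ ^ (l - 1) * sin θ := by
    rw [← rpow_add_one hs.ne', sub_add_cancel]
  simp only [Pi.mul_apply, e]
  field_simp
  linear_combination (sin θ ^ (l - 1) * l) * sin_sq_add_cos_sq θ

theorem integral_sin_rpow_sub_one_mul_cos {l : ℝ} (hl : 0 < l) :
    ∫ θ in (0:ℝ)..π, sin θ ^ (l - 1) * cos θ = 0 := by
  rw [intervalIntegral.integral_eq_sub_of_hasDerivAt_of_le pi_pos.le (f := fun θ => sin θ ^ l / l)]
  · simp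
  · exact ((continuous_sin.rpow_const fun _ => Or.inr hl.le).div_const l).continuousOn
  · intro θ hθ
    refine (((hasDerivAt_sin θ).rpow_const (p := l)
      (Or.inl (sin_pos_of_mem_Ioo hθ).ne')).div_const l).congr_deriv ?_
    field_simp
  · exact (intervalIntegrable_sin_rpow_sub_one hl).mul_continuousOn continuous_cos.continuousOn

theorem integral_sin_rpow_sub_one_mul_cos_sq {l : ℝ} (hl : 0 < l) :
    ∫ θ in (0:ℝ)..π, sin θ ^ (l - 1) * cos θ ^ 2 = l⁻¹ * ∫ θ in (0:ℝ)..π, sin θ ^ (l + 1) := by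
  have hi : IntervalIntegrable (fun θ => sin θ ^ (l - 1) * cos θ ^ 2) volume 0 π :=
    (intervalIntegrable_sin_rpow_sub_one hl).mul_continuousOn (by fun_prop)
  have hj : IntervalIntegrable (fun θ => sin θ ^ (l + 1)) volume 0 π :=
    (continuous_sin.rpow_const fun _ => Or.inr (by positivity)).intervalIntegrable 0 π
  have h := intervalIntegral.integral_eq_sub_of_hasDerivAt_of_le pi_pos.le
    (f := fun θ => sin θ ^ l * cos θ)
    (f' := fun θ => l * (sin θ ^ (l - 1) * cos θ ^ 2) - sin θ ^ (l + 1))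
    ((continuous_sin.rpow_const fun _ => Or.inr hl.le).mul continuous_cos).continuousOn
    (fun θ hθ => by
      have hs := sin_pos_of_mem_Ioo hθ
      refine (((hasDerivAt_sin θ).rpow_const (p := l) (Or.inl hs.ne')).mul
        (hasDerivAt_cos θ)).congr_deriv ?_
      rw [rpow_add_one hs.ne']
      ring)
    ((hi.const_mul l).sub hj)
  rw [intervalIntegral.integral_sub (hi.const_mul l) hj, intervalIntegral.integral_const_mul] at h
  simp only [sin_pi, sin_zero, zero_rpow hl.ne', zero_mul, sub_zero] at h
  rw [← sub_eq_zero.1 h, inv_mul_cancel_left₀ hl.ne']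

theorem tendsto_integral_sin_rpow_add_one :
    Tendsto (fun l : ℝ => ∫ θ in (0:ℝ)..π, sin θ ^ (l + 1)) (𝓝[>] 0) (𝓝 2) := by
  have h2 : ∫ θ in (0:ℝ)..π, sin θ = 2 := by
    rw [integral_sin, cos_zero, cos_pi]
    norm_num
  rw [← h2]
  refine intervalIntegral.tendsto_integral_filter_of_dominated_convergence (fun _ => 1) ?_ ?_
    (by simp) ?_
  · filter_upwards [self_mem_nhdsWithin] with l (hl : 0 < l)
    exact (continuous_sin.rpow_const fun _ => Or.inr (by positivity)).aestronglyMeasurable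
  · filter_upwards [self_mem_nhdsWithin] with l (hl : 0 < l)
    refine .of_forall fun θ hθ => ?_
    rw [Set.uIoc_of_le pi_pos.le] at hθ
    have hs := sin_nonneg_of_nonneg_of_le_pi hθ.1.le hθ.2
    rw [norm_of_nonneg (by positivity)]
    exact rpow_le_one hs (sin_le_one θ) (by positivity)
  · refine .of_forall fun θ _ => ?_
    have hc : ContinuousAt (fun l : ℝ => sin θ ^ (l + 1)) 0 :=
      continuousAt_const.rpow (by fun_prop) (Or.inr (by norm_num))
    simpa using hc.tendsto.mono_left nhdsWithin_le_nhds

/-- If `E` vanishes for `l = 0`, `θ = 0` and `θ = π`, the weighted integral tends to `0`. -/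
theorem tendsto_integral_sin_rpow_sub_one_mul_zero {E : ℝ → ℝ → ℝ}
    (hE : ContDiff ℝ 2 (fun p : ℝ × ℝ => E p.1 p.2)) (hE0 : ∀ θ ∈ Set.Icc (0:ℝ) π, E 0 θ = 0)
    (hl0 : ∀ l, E l 0 = 0) (hlpi : ∀ l, E l π = 0) :
    Tendsto (fun l : ℝ => ∫ θ in (0:ℝ)..π, sin θ ^ (l - 1) * E l θ) (𝓝[>] 0) (𝓝 0) := by
  obtain ⟨K, hK0, hK⟩ := exists_abs_sub_le_mul_of_contDiff hE hE0
  have hlim : Tendsto (fun l : ℝ => K * (π / 2) * l * |π - 0|) (𝓝[>] 0) (𝓝 0) := by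
    have hc : Continuous fun l : ℝ => K * (π / 2) * l * |π - 0| := by fun_prop
    simpa using (hc.tendsto 0).mono_left nhdsWithin_le_nhds
  refine squeeze_zero_norm' ?_ hlim
  filter_upwards [Ioo_mem_nhdsGT (zero_lt_one (α := ℝ))] with l hl
  refine intervalIntegral.norm_integral_le_of_norm_le_const fun θ hθ => ?_
  rw [Set.uIoc_of_le pi_pos.le] at hθ
  have hθ' : θ ∈ Set.Icc 0 π := Set.Ioc_subset_Icc_self hθ
  have hl' : l ∈ Set.Icc (0:ℝ) 1 := Set.Ioo_subset_Icc_self hl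
  rcases hθ.2.eq_or_lt with rfl | hθpi
  · rw [hlpi, mul_zero, norm_zero]
    have := hl.1
    positivity
  have hs := sin_pos_of_mem_Ioo ⟨hθ.1, hθpi⟩
  have hb : |E l θ| ≤ K * (π / 2 * sin θ) * l := by
    rcases le_total θ (π / 2) with h | h
    · have h1 := hK l hl' θ hθ' 0 (Set.left_mem_Icc.2 pi_pos.le)
      rw [hl0, sub_zero, sub_zero, abs_of_pos hθ.1] at h1
      refine h1.trans ?_
      gcongr
      · exact hl.1.le
      · exact le_pi_div_two_mul_sin hθ.1.le h
    · have h1 := hK l hl' θ hθ' π (Set.right_mem_Icc.2 pi_pos.le)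
      rw [hlpi, sub_zero, abs_sub_comm, abs_of_pos (sub_pos.2 hθpi)] at h1
      refine h1.trans ?_
      gcongr
      · exact hl.1.le
      · rw [← sin_pi_sub]
        exact le_pi_div_two_mul_sin (by linarith) (by linarith)
  have hr : sin θ ^ (l - 1) * sin θ ≤ 1 := by
    rw [← rpow_add_one hs.ne', sub_add_cancel]
    exact rpow_le_one hs.le (sin_le_one θ) hl.1.le
  rw [norm_mul, norm_of_nonneg (by positivity), norm_eq_abs]
  calc sin θ ^ (l - 1) * |E l θ| ≤ sin θ ^ (l - 1) * (K * (π / 2 * sin θ) * l) := by gcongr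
    _ = K * (π / 2) * l * (sin θ ^ (l - 1) * sin θ) := by ring
    _ ≤ K * (π / 2) * l := mul_le_of_le_one_right (by have := hl.1; positivity) hr

/-- Endpoint concentration: if `f` is smooth and `f(0,θ) = 0` for `θ ∈ [0,π]`, then
`∫₀^π (sin θ)^{λ−1} f(λ,θ) dθ → ∂_λ f(0,0) + ∂_λ f(0,π)` as `λ → 0⁺`. -/
theorem sin_rpow_weighted_integral_limit
    (f : ℝ → ℝ → ℝ)
    (hf : ContDiff ℝ (⊤ : ℕ∞) (fun p : ℝ × ℝ => f p.1 p.2))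
    (hf0 : ∀ θ ∈ Set.Icc (0:ℝ) π, f 0 θ = 0) :
    Tendsto (fun l : ℝ => ∫ θ in Set.Ioo (0:ℝ) π, Real.sin θ ^ (l - 1) * f l θ)
      (𝓝[>] (0:ℝ))
      (𝓝 (deriv (fun l : ℝ => f l 0) 0 + deriv (fun l : ℝ => f l π) 0)) := by
  have hf2 : ContDiff ℝ 2 (fun p : ℝ × ℝ => f p.1 p.2) := contDiff_infty.1 hf 2
  have h0 : f 0 0 = 0 := hf0 0 (Set.left_mem_Icc.2 pi_pos.le)
  have hpi : f 0 π = 0 := hf0 π (Set.right_mem_Icc.2 pi_pos.le)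
  have hs (θ : ℝ) : ContDiff ℝ 2 (fun l => f l θ) :=
    hf2.comp (contDiff_id.prodMk contDiff_const)
  have hslope (θ : ℝ) (hθ : f 0 θ = 0) :
      Tendsto (fun l => l⁻¹ * f l θ) (𝓝[>] 0) (𝓝 (deriv (fun l => f l θ) 0)) := by
    have h := ((hs θ).differentiable (by norm_num) 0).hasDerivAt.tendsto_slope_zero_right
    simpa [hθ] using h
  set A : ℝ → ℝ := fun l => (f l 0 + f l π) / 2 with hA
  set B : ℝ → ℝ := fun l => (f l 0 - f l π) / 2 with hB
  set E : ℝ → ℝ → ℝ := fun l θ => f l θ - (A l * cos θ ^ 2 + B l * cos θ) with hE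
  have hA2 : ContDiff ℝ 2 A := ((hs 0).add (hs π)).div_const 2
  have hB2 : ContDiff ℝ 2 B := ((hs 0).sub (hs π)).div_const 2
  have hE2 : ContDiff ℝ 2 (fun p : ℝ × ℝ => E p.1 p.2) :=
    hf2.sub (((hA2.comp contDiff_fst).mul (contDiff_snd.cos.pow 2)).add
      ((hB2.comp contDiff_fst).mul contDiff_snd.cos))
  have hE_lim := tendsto_integral_sin_rpow_sub_one_mul_zero hE2
    (fun θ hθ => by simp [hE, hA, hB, hf0 θ hθ, h0, hpi])
    (fun l => by simp only [hE, hA, hB, cos_zero]; ring)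
    (fun l => by simp only [hE, hA, hB, cos_pi]; ring)
  have hA_lim := (((hslope 0 h0).add (hslope π hpi)).div_const 2).mul
    tendsto_integral_sin_rpow_add_one
  have h := hA_lim.add hE_lim
  rw [div_mul_cancel₀ _ two_ne_zero, add_zero] at h
  refine h.congr' ?_
  filter_upwards [self_mem_nhdsWithin] with l (hl : 0 < l)
  have hi (g : ℝ → ℝ) (hg : Continuous g) :
      IntervalIntegrable (fun θ => sin θ ^ (l - 1) * g θ) volume 0 π :=
    (intervalIntegrable_sin_rpow_sub_one hl).mul_continuousOn hg.continuousOn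
  have hEc : Continuous (E l) := hE2.continuous.comp (Continuous.prodMk_right l)
  have hsplit : (fun θ => sin θ ^ (l - 1) * f l θ) = fun θ =>
      A l * (sin θ ^ (l - 1) * cos θ ^ 2) + B l * (sin θ ^ (l - 1) * cos θ)
        + sin θ ^ (l - 1) * E l θ := by
    funext θ
    simp only [hE]
    ring
  have h1 := (hi (fun θ => cos θ ^ 2) (by fun_prop)).const_mul (A l)
  have h2 := (hi cos continuous_cos).const_mul (B l)
  rw [← integral_Ioc_eq_integral_Ioo, ← intervalIntegral.integral_of_le pi_pos.le, hsplit,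
    intervalIntegral.integral_add (h1.add h2) (hi _ hEc), intervalIntegral.integral_add h1 h2,
    intervalIntegral.integral_const_mul, intervalIntegral.integral_const_mul,
    integral_sin_rpow_sub_one_mul_cos hl, integral_sin_rpow_sub_one_mul_cos_sq hl]
  simp only [hA]
  ring
end

section
/- Let δ > 0 and let f : [0,δ] → ℝ be smooth with |τ·f(τ)| < 1/2 for all τ ∈ [0,δ]. For complex λ with Re λ > 0, the integral F(λ) = ∫₀^δ τ^{λ−1}·(1 + τ f(τ))^{λ−1} dτ converges (here a^{λ−1} = exp((λ−1)·log a) with the real logarithm, noting 1 + τ f(τ) > 1/2 > 0). Then there exists a function p, holomorphic on {λ ∈ ℂ : Re λ > −1}, such that F(λ) = 1/λ + p(λ) for all λ with Re λ > 0; in particular F extends meromorphically to {Re λ > −1} with a single simple pole at λ = 0 of residue 1. -/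
open Real Filter Topology MeasureTheory

/-- Differentiation under the integral sign for a holomorphic integrand that is dominated, near
`x₀`, by an integrable function; Cauchy's estimate supplies the bound on the derivative. -/
lemma differentiableAt_integral_of_dominated_holomorphic {α : Type*} [MeasurableSpace α]
    {μ : Measure α} {G G' : ℂ → α → ℂ} {bound : α → ℝ} {x₀ : ℂ} {r : ℝ} (hr : 0 < r)
    (hmeas : ∀ x, AEStronglyMeasurable (G x) μ) (hmeas' : AEStronglyMeasurable (G' x₀) μ)
    (hbound : ∀ᵐ a ∂μ, ∀ x ∈ Metric.ball x₀ (2 * r), ‖G x a‖ ≤ bound a)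
    (hint : Integrable bound μ) (hderiv : ∀ a x, HasDerivAt (G · a) (G' x a) x) :
    DifferentiableAt ℂ (fun x => ∫ a, G x a ∂μ) x₀ := by
  have hsub : ∀ x ∈ Metric.ball x₀ (r / 2), ∀ z ∈ Metric.sphere x r,
      z ∈ Metric.ball x₀ (2 * r) := by
    intro x hx z hz
    rw [Metric.mem_ball] at hx ⊢
    rw [Metric.mem_sphere] at hz
    linarith [dist_triangle z x x₀]
  refine (hasDerivAt_integral_of_dominated_loc_of_deriv_le
    (Metric.ball_mem_nhds x₀ (half_pos hr)) (.of_forall hmeas) ?_ hmeas' (F' := G')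
    (bound := fun a => bound a / r) ?_ (hint.div_const r) ?_).2.differentiableAt
  · refine hint.mono' (hmeas x₀) ?_
    filter_upwards [hbound] with a ha
    exact ha x₀ (Metric.mem_ball_self (by linarith))
  · filter_upwards [hbound] with a ha x hx
    rw [← (hderiv a x).deriv]
    refine Complex.norm_deriv_le_of_forall_mem_sphere_norm_le hr ?_ fun z hz => ha z (hsub x hx z hz)
    exact Differentiable.diffContOnCl fun z => (hderiv a z).differentiableAt
  · exact .of_forall fun a x _ => hderiv a x

lemma abs_log_one_add_le_two_mul_abs {x : ℝ} (hx : |x| < 1 / 2) :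
    |Real.log (1 + x)| ≤ 2 * |x| := by
  obtain ⟨h1, h2⟩ := abs_lt.1 hx
  have hpos : 0 < 1 + x := by linarith
  have hup := Real.log_le_sub_one_of_pos hpos
  have hlo := Real.one_sub_inv_le_log_of_pos hpos
  have hinv : 1 - (1 + x)⁻¹ = x / (1 + x) := by field_simp; ring
  have hquot : -(2 * |x|) ≤ x / (1 + x) := by
    rw [le_div_iff₀ hpos]
    nlinarith [neg_abs_le x, abs_nonneg x]
  rw [abs_le]
  constructor
  · linarith
  · linarith [le_abs_self x, abs_nonneg x]

lemma norm_exp_sub_one_le_norm_mul_exp (w : ℂ) :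
    ‖Complex.exp w - 1‖ ≤ ‖w‖ * Real.exp ‖w‖ := by
  simpa using Complex.norm_exp_sub_sum_le_norm_mul_exp w 1

lemma norm_exp_mul_log_eq_rpow {τ : ℝ} (hτ : 0 < τ) (l : ℂ) :
    ‖Complex.exp (l * (Real.log τ : ℂ))‖ = τ ^ l.re := by
  rw [Complex.norm_exp, Complex.re_mul_ofReal, Real.rpow_def_of_pos hτ, mul_comm]

lemma rpow_le_rpow_add_rpow {τ a b c : ℝ} (hτ : 0 < τ) (hab : a ≤ b) (hbc : b ≤ c) :
    τ ^ b ≤ τ ^ a + τ ^ c := by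
  rcases le_total τ 1 with h | h
  · linarith [Real.rpow_le_rpow_of_exponent_ge hτ h hab, Real.rpow_nonneg hτ.le c]
  · linarith [Real.rpow_le_rpow_of_exponent_le h hbc, Real.rpow_nonneg hτ.le a]

/-- The integrand `τ^{λ-1} (e^{(λ-1) u} - 1)` has its singularity at `τ = 0` weakened by one order
when `u = O(τ)`. -/
lemma norm_exp_mul_log_mul_exp_sub_one_le {τ u C δ s R : ℝ} {l : ℂ} (hτ : 0 < τ) (hτδ : τ ≤ δ)
    (hC : 0 ≤ C) (hu : |u| ≤ C * τ) (hs : -1 + s ≤ l.re) (hR : ‖l‖ ≤ R) :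
    ‖Complex.exp ((l - 1) * (Real.log τ : ℂ)) * (Complex.exp ((l - 1) * (u : ℂ)) - 1)‖ ≤
      (R + 1) * C * Real.exp ((R + 1) * (C * δ)) * (τ ^ (s - 1) + τ ^ R) := by
  have hR0 : 0 ≤ R := (norm_nonneg l).trans hR
  have hl : ‖l - 1‖ ≤ R + 1 := by
    have := norm_sub_le l 1
    rw [norm_one] at this
    linarith
  have hw : ‖(l - 1) * (u : ℂ)‖ ≤ (R + 1) * (C * τ) := by
    rw [norm_mul, Complex.norm_real, Real.norm_eq_abs]
    exact mul_le_mul hl hu (abs_nonneg u) (by linarith)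
  have hexp : ‖Complex.exp ((l - 1) * (u : ℂ)) - 1‖ ≤
      (R + 1) * (C * τ) * Real.exp ((R + 1) * (C * δ)) := by
    refine (norm_exp_sub_one_le_norm_mul_exp _).trans ?_
    refine mul_le_mul hw (Real.exp_le_exp.2 (hw.trans ?_)) (Real.exp_pos _).le (by positivity)
    gcongr
  have hpow : τ ^ l.re ≤ τ ^ (s - 1) + τ ^ R :=
    rpow_le_rpow_add_rpow hτ (by linarith) ((Complex.re_le_norm l).trans hR)
  rw [norm_mul, norm_exp_mul_log_eq_rpow hτ, Complex.sub_re, Complex.one_re]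
  calc τ ^ (l.re - 1) * ‖Complex.exp ((l - 1) * (u : ℂ)) - 1‖
      ≤ τ ^ (l.re - 1) * ((R + 1) * (C * τ) * Real.exp ((R + 1) * (C * δ))) := by gcongr
    _ = (R + 1) * C * Real.exp ((R + 1) * (C * δ)) * τ ^ l.re := by
        rw [Real.rpow_sub_one hτ.ne']; field_simp
    _ ≤ _ := by gcongr

lemma integrableOn_rpow_add_rpow {δ a b : ℝ} (hδ : 0 < δ) (ha : -1 < a) (hb : -1 < b) :
    IntegrableOn (fun τ : ℝ => τ ^ a + τ ^ b) (Set.Ioo 0 δ) :=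
  ((intervalIntegral.integrableOn_Ioo_rpow_iff hδ).2 ha).add
    ((intervalIntegral.integrableOn_Ioo_rpow_iff hδ).2 hb)

lemma exp_mul_log_eq_cpow {τ : ℝ} (hτ : 0 < τ) (l : ℂ) :
    Complex.exp (l * (Real.log τ : ℂ)) = (τ : ℂ) ^ l := by
  rw [Complex.cpow_def_of_ne_zero (by exact_mod_cast hτ.ne'), Complex.ofReal_log hτ.le, mul_comm]

lemma integrableOn_exp_mul_log {δ : ℝ} (hδ : 0 < δ) {l : ℂ} (hl : 0 < l.re) :
    IntegrableOn (fun τ : ℝ => Complex.exp ((l - 1) * (Real.log τ : ℂ))) (Set.Ioo 0 δ) := by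
  have h : IntervalIntegrable (fun τ : ℝ => (τ : ℂ) ^ (l - 1)) volume 0 δ :=
    intervalIntegral.intervalIntegrable_cpow' (by simpa using hl)
  rw [intervalIntegrable_iff_integrableOn_Ioo_of_le hδ.le] at h
  exact h.congr_fun (fun τ hτ => (exp_mul_log_eq_cpow hτ.1 _).symm) measurableSet_Ioo

lemma integral_exp_mul_log {δ : ℝ} (hδ : 0 < δ) {l : ℂ} (hl : 0 < l.re) :
    ∫ τ in Set.Ioo (0 : ℝ) δ, Complex.exp ((l - 1) * (Real.log τ : ℂ)) = (δ : ℂ) ^ l / l := by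
  have hl0 : l ≠ 0 := by rintro rfl; simp at hl
  rw [setIntegral_congr_fun measurableSet_Ioo
    (fun τ hτ => exp_mul_log_eq_cpow hτ.1 (l - 1)), ← integral_Ioc_eq_integral_Ioo,
    ← intervalIntegral.integral_of_le hδ.le, integral_cpow (Or.inl (by simpa using hl))]
  simp [hl0]

/-- Meromorphic continuation of `F(λ) = ∫₀^δ τ^{λ−1} (1 + τ f(τ))^{λ−1} dτ`:
the integral converges for `Re λ > 0` and `F(λ) = 1/λ + p(λ)` with `p` holomorphic on
`{Re λ > −1}`; in particular `F` has a single simple pole at `λ = 0` with residue `1`.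
Here `a^{λ−1} = exp((λ−1) log a)` for `a > 0`. -/
theorem meromorphic_continuation_endpoint_integral
    (δ : ℝ) (hδ : 0 < δ) (f : ℝ → ℝ) (hf : ContDiff ℝ (⊤ : ℕ∞) f)
    (hfb : ∀ τ ∈ Set.Icc (0:ℝ) δ, |τ * f τ| < 1/2) :
    (∀ l : ℂ, 0 < l.re →
      IntegrableOn
        (fun τ : ℝ => Complex.exp ((l - 1) *
          ((Real.log τ : ℂ) + (Real.log (1 + τ * f τ) : ℂ))))
        (Set.Ioo 0 δ)) ∧
    ∃ p : ℂ → ℂ, DifferentiableOn ℂ p {l : ℂ | -1 < l.re} ∧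
      ∀ l : ℂ, 0 < l.re →
        (∫ τ in Set.Ioo (0:ℝ) δ, Complex.exp ((l - 1) *
          ((Real.log τ : ℂ) + (Real.log (1 + τ * f τ) : ℂ)))) = 1 / l + p l := by
  obtain ⟨M, hM⟩ := isCompact_Icc.exists_bound_of_continuousOn (s := Set.Icc (0 : ℝ) δ)
    hf.continuous.continuousOn
  have hM0 : 0 ≤ M := (norm_nonneg _).trans (hM 0 ⟨le_rfl, hδ.le⟩)
  set u : ℝ → ℝ := fun τ => Real.log (1 + τ * f τ) with hu
  have hubound : ∀ τ ∈ Set.Ioo (0 : ℝ) δ, |u τ| ≤ 2 * M * τ := by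
    intro τ hτ
    have hτ' : τ ∈ Set.Icc (0 : ℝ) δ := Set.Ioo_subset_Icc_self hτ
    have hfM : |f τ| ≤ M := hM τ hτ'
    calc |u τ| ≤ 2 * |τ * f τ| := abs_log_one_add_le_two_mul_abs (hfb τ hτ')
      _ = 2 * |f τ| * τ := by rw [abs_mul, abs_of_pos hτ.1]; ring
      _ ≤ 2 * M * τ := by have := hτ.1.le; gcongr
  have humeas : Measurable u :=
    Real.measurable_log.comp (measurable_const.add (measurable_id.mul hf.continuous.measurable))
  let G : ℂ → ℝ → ℂ := fun l τ =>
    Complex.exp ((l - 1) * (Real.log τ : ℂ)) * (Complex.exp ((l - 1) * (u τ : ℂ)) - 1)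
  let G' : ℂ → ℝ → ℂ := fun l τ =>
    Complex.exp ((l - 1) * (Real.log τ : ℂ)) * (Real.log τ : ℂ) *
        (Complex.exp ((l - 1) * (u τ : ℂ)) - 1) +
      Complex.exp ((l - 1) * (Real.log τ : ℂ)) *
        (Complex.exp ((l - 1) * (u τ : ℂ)) * (u τ : ℂ))
  have hGmeas : ∀ l, Measurable (G l) := fun l => by fun_prop
  have hGmeas' : ∀ l, Measurable (G' l) := fun l => by fun_prop
  have hexp : ∀ (c l : ℂ), HasDerivAt (fun l => Complex.exp ((l - 1) * c))
      (Complex.exp ((l - 1) * c) * c) l := fun c l => by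
    simpa using (((hasDerivAt_id l).sub_const 1).mul_const c).cexp
  have hGderiv : ∀ τ l, HasDerivAt (G · τ) (G' l τ) l := fun τ l =>
    (hexp _ l).mul ((hexp _ l).sub_const 1)
  have hGbound : ∀ {s R : ℝ} {l : ℂ}, -1 + s ≤ l.re → ‖l‖ ≤ R → ∀ τ ∈ Set.Ioo (0 : ℝ) δ,
      ‖G l τ‖ ≤ (R + 1) * (2 * M) * Real.exp ((R + 1) * (2 * M * δ)) * (τ ^ (s - 1) + τ ^ R) :=
    fun hs hR τ hτ => norm_exp_mul_log_mul_exp_sub_one_le hτ.1 hτ.2.le (by positivity)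
      (hubound τ hτ) hs hR
  have hGint : ∀ l : ℂ, -1 < l.re → IntegrableOn (G l) (Set.Ioo 0 δ) := by
    intro l hl
    refine Integrable.mono' ((integrableOn_rpow_add_rpow hδ (a := l.re + 1 - 1) (b := ‖l‖)
      (by linarith) (by linarith [norm_nonneg l])).const_mul _)
      (hGmeas l).aestronglyMeasurable
      (ae_restrict_of_forall_mem measurableSet_Ioo (hGbound (by linarith) le_rfl))
  have hGdiff : ∀ l : ℂ, -1 < l.re →
      DifferentiableAt ℂ (fun l => ∫ τ in Set.Ioo (0 : ℝ) δ, G l τ) l := by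
    intro l hl
    set s : ℝ := (l.re + 1) / 2 with hs
    have hs0 : 0 < s := by linarith
    refine differentiableAt_integral_of_dominated_holomorphic (half_pos hs0)
      (fun x => (hGmeas x).aestronglyMeasurable) (hGmeas' l).aestronglyMeasurable ?_
      ((integrableOn_rpow_add_rpow hδ (a := s - 1) (b := ‖l‖ + s)
        (by linarith) (by linarith [norm_nonneg l])).const_mul
          ((‖l‖ + s + 1) * (2 * M) * Real.exp ((‖l‖ + s + 1) * (2 * M * δ)))) hGderiv
    refine ae_restrict_of_forall_mem measurableSet_Ioo fun τ hτ x hx => hGbound ?_ ?_ τ hτ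
    all_goals
      rw [Metric.mem_ball, dist_eq_norm] at hx
    · have := (Complex.abs_re_le_norm (x - l))
      rw [Complex.sub_re] at this
      linarith [(abs_le.1 this).1]
    · linarith [norm_le_norm_add_norm_sub' x l]
  have hsplit : ∀ (l : ℂ) (τ : ℝ), Complex.exp ((l - 1) *
      ((Real.log τ : ℂ) + (Real.log (1 + τ * f τ) : ℂ))) =
        Complex.exp ((l - 1) * (Real.log τ : ℂ)) + G l τ := by
    intro l τ
    simp only [G, hu]
    rw [mul_add, Complex.exp_add]
    ring
  simp only [hsplit]
  refine ⟨fun l hl => (integrableOn_exp_mul_log hδ hl).add (hGint l (by linarith)),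
    fun l => dslope (fun z : ℂ => (δ : ℂ) ^ z) 0 l + ∫ τ in Set.Ioo (0 : ℝ) δ, G l τ, ?_, ?_⟩
  · have hδ0 : (δ : ℂ) ≠ 0 := by exact_mod_cast hδ.ne'
    have hpow : Differentiable ℂ (fun z : ℂ => (δ : ℂ) ^ z) := fun z =>
      differentiableAt_id.const_cpow (Or.inl hδ0)
    have hslope : Differentiable ℂ (dslope (fun z : ℂ => (δ : ℂ) ^ z) 0) :=
      differentiableOn_univ.1
        ((Complex.differentiableOn_dslope univ_mem).2 hpow.differentiableOn)
    exact hslope.differentiableOn.add fun l hl => (hGdiff l hl).differentiableWithinAt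
  · intro l hl
    have hl0 : l ≠ 0 := by rintro rfl; simp at hl
    beta_reduce
    rw [integral_add (integrableOn_exp_mul_log hδ hl) (hGint l (by linarith)),
      integral_exp_mul_log hδ hl, dslope_of_ne _ hl0, slope_def_field]
    simp only [Complex.cpow_zero, sub_zero]
    ring
end

section
/- Let ε > 0, N ≥ 1, let A : [0,ε] → M_N(ℝ) and r : [0,ε] → ℝ^N be smooth, and let k be a natural number. Then there exists a smooth map w̃ : [0,ε] → ℝ^N such that w(ρ) := ρ^{k+1}·w̃(ρ) satisfies w′(ρ) + A(ρ)·w(ρ) = ρ^{k}·r(ρ) for all ρ ∈ [0,ε]. -/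
open Real Filter Topology

/-- Moments of a smooth curve along rays are smooth functions of the endpoint. -/
theorem contDiff_integral_pow_smul_comp_mul {E : Type*} [NormedAddCommGroup E] [NormedSpace ℝ E]
    {g : ℝ → E} (hg : ContDiff ℝ (⊤ : ℕ∞) g) (m n : ℕ) :
    ContDiff ℝ m (fun t : ℝ => ∫ s in (0:ℝ)..1, s ^ n • g (t * s)) := by
  induction m generalizing n g with
  | zero =>
    rw [Nat.cast_zero, contDiff_zero]
    have hgc := hg.continuous
    apply intervalIntegral.continuous_parametric_intervalIntegral_of_continuous'
    unfold Function.uncurry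
    fun_prop
  | succ m ih =>
    obtain ⟨hgd, hg'⟩ := contDiff_infty_iff_deriv.mp hg
    have hgc := hg.continuous
    have hgc' := hg'.continuous
    have hder (t : ℝ) : HasDerivAt (fun t : ℝ => ∫ s in (0:ℝ)..1, s ^ n • g (t * s))
        (∫ s in (0:ℝ)..1, s ^ (n + 1) • deriv g (t * s)) t := by
      have hcont : Continuous (fun p : ℝ × ℝ => p.2 ^ (n + 1) • deriv g (p.1 * p.2)) := by
        fun_prop
      obtain ⟨C, hC⟩ := ((isCompact_closedBall t 1).prod
        (isCompact_Icc (a := (0:ℝ)) (b := 1))).exists_bound_of_continuousOn hcont.continuousOn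
      refine (intervalIntegral.hasDerivAt_integral_of_dominated_loc_of_deriv_le
        (F' := fun t s => s ^ (n + 1) • deriv g (t * s)) (bound := fun _ => C)
        (Metric.closedBall_mem_nhds t one_pos) (Eventually.of_forall fun x => ?_) ?_ ?_ ?_
        intervalIntegrable_const ?_).2
      · exact Continuous.aestronglyMeasurable (by fun_prop)
      · exact Continuous.intervalIntegrable (by fun_prop) _ _
      · exact Continuous.aestronglyMeasurable (by fun_prop)
      · refine Eventually.of_forall fun s hs x hx => hC (x, s) ⟨hx, ?_⟩
        rw [Set.uIoc_of_le zero_le_one] at hs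
        exact ⟨hs.1.le, hs.2⟩
      · refine Eventually.of_forall fun s _ x _ => ?_
        have h := ((hgd (x * s)).hasDerivAt.scomp x
          ((hasDerivAt_id x).mul_const s)).fun_const_smul (s ^ n)
        simpa [pow_succ, mul_smul, Function.comp_def] using h
    rw [Nat.cast_succ, contDiff_succ_iff_deriv]
    refine ⟨fun t => (hder t).differentiableAt, by simp, ?_⟩
    rw [funext fun t => (hder t).deriv]
    exact ih hg' (n + 1)

/-- **Hadamard's lemma** for curves: a smooth curve vanishing at the origin is divisible by the
parameter. -/
theorem exists_contDiff_eq_smul_of_apply_zero {E : Type*} [NormedAddCommGroup E] [NormedSpace ℝ E]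
    [CompleteSpace E] {w : ℝ → E} (hw : ContDiff ℝ (⊤ : ℕ∞) w) (h0 : w 0 = 0) :
    ∃ v : ℝ → E, ContDiff ℝ (⊤ : ℕ∞) v ∧ ∀ t, w t = t • v t := by
  obtain ⟨hd, hw'⟩ := contDiff_infty_iff_deriv.mp hw
  refine ⟨fun t => ∫ s in (0:ℝ)..1, deriv w (t * s), ?_, fun t => ?_⟩
  · rw [contDiff_infty]
    intro m
    simpa using contDiff_integral_pow_smul_comp_mul hw' m 0
  · rw [intervalIntegral.smul_integral_comp_mul_left,
      intervalIntegral.integral_deriv_eq_sub (fun x _ => hd x)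
        (hw'.continuous.intervalIntegrable _ _)]
    simp [h0]

/-- A smooth curve on a symmetric compact interval agrees with a globally smooth curve on any
smaller interval. -/
theorem exists_contDiff_eqOn_Icc {E : Type*} [NormedAddCommGroup E] [NormedSpace ℝ E]
    {S T : ℝ} (hS : 0 < S) (hST : S < T) {f : ℝ → E}
    (hf : ContDiffOn ℝ (⊤ : ℕ∞) f (Set.Icc (-T) T)) :
    ∃ F : ℝ → E, ContDiff ℝ (⊤ : ℕ∞) F ∧ Set.EqOn F f (Set.Icc (-S) S) := by
  let χ : ContDiffBump (0 : ℝ) := ⟨S, (S + T) / 2, hS, by linarith⟩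
  refine ⟨fun t => χ t • f t, ?_, fun t ht => ?_⟩
  · rw [contDiff_iff_contDiffAt]
    intro t
    by_cases ht : t ∈ tsupport χ
    · have ht' : |t| ≤ (S + T) / 2 := by
        simpa [χ.tsupport_eq, χ] using ht
      obtain ⟨h1, h2⟩ := abs_le.mp ht'
      exact χ.contDiff.contDiffAt.smul
        (hf.contDiffAt (Icc_mem_nhds (by linarith) (by linarith)))
    · refine contDiffAt_const (c := (0 : E)) |>.congr_of_eventuallyEq ?_
      filter_upwards [notMem_tsupport_iff_eventuallyEq.mp ht] with s hs
      simp [hs]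
  · have h1 : χ t = 1 := χ.one_of_mem_closedBall (by simpa [χ] using abs_le.mpr ht)
    simp [h1]

/-- Coordinatewise truncation to the box `[-R, R]^ι`. -/
def boxTruncation {ι : Type*} (R : ℝ) (x : ι → ℝ) : ι → ℝ := fun i => max (-R) (min R (x i))

theorem norm_boxTruncation_le {ι : Type*} [Fintype ι] {R : ℝ} (hR : 0 ≤ R) (x : ι → ℝ) :
    ‖boxTruncation R x‖ ≤ R := by
  rw [pi_norm_le_iff_of_nonneg hR]
  intro i
  rw [Real.norm_eq_abs, abs_le]
  exact ⟨le_max_left _ _, max_le (by linarith) (min_le_left _ _)⟩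

theorem norm_boxTruncation_le_norm {ι : Type*} [Fintype ι] {R : ℝ} (hR : 0 ≤ R) (x : ι → ℝ) :
    ‖boxTruncation R x‖ ≤ ‖x‖ := by
  rw [pi_norm_le_iff_of_nonneg (norm_nonneg x)]
  intro i
  obtain ⟨h1, h2⟩ := abs_le.mp (norm_le_pi_norm x i)
  rw [Real.norm_eq_abs, abs_le]
  exact ⟨le_max_of_le_right (le_min (by linarith [norm_nonneg x]) h1),
    max_le (by linarith [norm_nonneg x]) ((min_le_right _ _).trans h2)⟩

theorem boxTruncation_eq_self {ι : Type*} [Fintype ι] {R : ℝ} {x : ι → ℝ} (hx : ‖x‖ ≤ R) :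
    boxTruncation R x = x := by
  funext i
  obtain ⟨h1, h2⟩ := abs_le.mp ((norm_le_pi_norm x i).trans hx)
  rw [boxTruncation, min_eq_right h2, max_eq_right h1]

theorem lipschitzWith_boxTruncation {ι : Type*} [Fintype ι] (R : ℝ) :
    LipschitzWith 1 (boxTruncation R : (ι → ℝ) → ι → ℝ) := by
  refine LipschitzWith.of_dist_le_mul fun x y => ?_
  rw [NNReal.coe_one, one_mul, dist_pi_le_iff dist_nonneg]
  intro i
  have h := ((LipschitzWith.id.const_min R).const_max (-R)).dist_le_mul (x i) (y i)
  rw [NNReal.coe_one, one_mul] at h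
  exact h.trans (dist_le_pi_dist x y i)

/-- Two-sided Grönwall bound on a symmetric interval. -/
theorem norm_le_gronwallBound_of_norm_deriv_le_symm {E : Type*} [NormedAddCommGroup E]
    [NormedSpace ℝ E] {f f' : ℝ → E} {K G T : ℝ} (hK : 0 ≤ K) (hG : 0 ≤ G)
    (hf : ∀ t ∈ Set.Icc (-T) T, HasDerivWithinAt f (f' t) (Set.Icc (-T) T) t)
    (h0 : f 0 = 0) (bound : ∀ t ∈ Set.Icc (-T) T, ‖f' t‖ ≤ K * ‖f t‖ + G) :
    ∀ t ∈ Set.Icc (-T) T, ‖f t‖ ≤ gronwallBound 0 K G T := by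
  have forward : ∀ f f' : ℝ → E,
      (∀ t ∈ Set.Icc (-T) T, HasDerivWithinAt f (f' t) (Set.Icc (-T) T) t) → f 0 = 0 →
      (∀ t ∈ Set.Icc (-T) T, ‖f' t‖ ≤ K * ‖f t‖ + G) →
      ∀ t ∈ Set.Icc 0 T, ‖f t‖ ≤ gronwallBound 0 K G T := by
    intro f f' hf h0 bound t ht
    have hsub : Set.Icc 0 T ⊆ Set.Icc (-T) T :=
      Set.Icc_subset_Icc_left (by linarith [ht.1, ht.2])
    refine (norm_le_gronwallBound_of_norm_deriv_right_le (f := f) (f' := f')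
      (fun s hs => (hf s (hsub hs)).continuousWithinAt.mono hsub)
      (fun s hs => ?_) (by simp [h0])
      (fun s hs => bound s (hsub (Set.Ico_subset_Icc_self hs))) t ht).trans
      (gronwallBound_mono le_rfl hG hK (by linarith [ht.2]))
    have hs' := hsub (Set.Ico_subset_Icc_self hs)
    exact (hf s hs').mono_of_mem_nhdsWithin
      (mem_of_superset (Icc_mem_nhdsGE hs.2) (Set.Icc_subset_Icc_left hs'.1))
  intro t ht
  rcases le_total 0 t with h | h
  · exact forward f f' hf h0 bound t ⟨h, ht.2⟩
  · have hneg : Set.MapsTo (fun s : ℝ => -s) (Set.Icc (-T) T) (Set.Icc (-T) T) :=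
      fun s hs => ⟨by linarith [hs.2], by linarith [hs.1]⟩
    have := forward (fun s => f (-s)) (fun s => -f' (-s)) (fun s hs => by
        simpa [Function.comp_def] using
          (hf (-s) (hneg hs)).scomp s (hasDerivAt_neg s).hasDerivWithinAt hneg)
      (by simpa using h0) (fun s hs => by simpa using bound (-s) (hneg hs)) (-t)
      ⟨by linarith, by linarith [ht.1]⟩
    simpa using this

/-- Global existence for inhomogeneous linear ODEs on a symmetric compact interval, with zero
initial value. -/
theorem exists_hasDerivWithinAt_linear {ι : Type*} [Fintype ι]
    {B : ℝ → (ι → ℝ) →L[ℝ] (ι → ℝ)} {g : ℝ → ι → ℝ} (hB : Continuous B) (hg : Continuous g)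
    {T : ℝ} (hT : 0 ≤ T) :
    ∃ w : ℝ → ι → ℝ, w 0 = 0 ∧ ∀ t ∈ Set.Icc (-T) T,
      HasDerivWithinAt w (B t (w t) + g t) (Set.Icc (-T) T) t := by
  have h0mem : (0 : ℝ) ∈ Set.Icc (-T) T := ⟨by linarith, hT⟩
  obtain ⟨K, hK⟩ := (isCompact_Icc (a := -T) (b := T)).exists_bound_of_continuousOn hB.continuousOn
  obtain ⟨G, hG⟩ := (isCompact_Icc (a := -T) (b := T)).exists_bound_of_continuousOn hg.continuousOn
  have hK0 : 0 ≤ K := (norm_nonneg _).trans (hK 0 h0mem)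
  have hG0 : 0 ≤ G := (norm_nonneg _).trans (hG 0 h0mem)
  set R := gronwallBound 0 K G T
  have hR : 0 ≤ R := by
    simpa [gronwallBound_x0] using gronwallBound_mono le_rfl hG0 hK0 hT
  lift K to NNReal using hK0
  lift T to NNReal using hT
  obtain ⟨L, hL⟩ : ∃ L : NNReal, (L : ℝ) = K * R + G := ⟨⟨K * R + G, by positivity⟩, rfl⟩
  have hPL : IsPicardLindelof (fun t x => B t (boxTruncation R x) + g t) (tmin := -T) (tmax := T)
      ⟨0, h0mem⟩ (0 : ι → ℝ) (L * T) 0 L K := by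
    constructor
    · intro t ht
      have h : LipschitzWith (‖B t‖₊ * 1) (fun x => B t (boxTruncation R x)) :=
        (B t).lipschitz.comp (lipschitzWith_boxTruncation R)
      refine LipschitzWith.lipschitzOnWith (LipschitzWith.of_dist_le_mul fun x y => ?_)
      rw [dist_add_right]
      refine (h.dist_le_mul x y).trans ?_
      gcongr
      simpa [← NNReal.coe_le_coe] using hK t ht
    · intro x _
      exact ((hB.clm_apply continuous_const).add hg).continuousOn
    · intro t ht x _
      rw [hL]
      refine (norm_add_le _ _).trans (add_le_add ?_ (hG t ht))
      exact ((B t).le_opNorm _).trans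
        (mul_le_mul (hK t ht) (norm_boxTruncation_le hR x) (norm_nonneg _) K.2)
    · simp
  obtain ⟨w, hw0, hw⟩ := hPL.exists_eq_forall_mem_Icc_hasDerivWithinAt₀
  have hbound := norm_le_gronwallBound_of_norm_deriv_le_symm K.2 hG0 hw hw0 fun t ht =>
    (norm_add_le _ _).trans (add_le_add (((B t).le_opNorm _).trans
      (mul_le_mul (hK t ht) (norm_boxTruncation_le_norm hR _) (norm_nonneg _) K.2)) (hG t ht))
  refine ⟨w, hw0, fun t ht => ?_⟩
  have h := hw t ht
  rwa [boxTruncation_eq_self (R := R) (hbound t ht)] at h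

/-- A smooth solution of `w' = B w + t ^ k r` vanishing at the origin is divisible by
`t ^ (k + 1)`. -/
theorem exists_contDiff_eq_pow_smul_of_hasDerivAt {E : Type*} [NormedAddCommGroup E]
    [NormedSpace ℝ E] [CompleteSpace E] {B : ℝ → E →L[ℝ] E} {r w : ℝ → E}
    (hB : ContDiff ℝ (⊤ : ℕ∞) B) (hr : ContDiff ℝ (⊤ : ℕ∞) r) (hw : ContDiff ℝ (⊤ : ℕ∞) w)
    (h0 : w 0 = 0) {U : Set ℝ} (hU : IsOpen U) {k : ℕ}
    (hode : ∀ t ∈ U, HasDerivAt w (B t (w t) + t ^ k • r t) t) :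
    ∃ v : ℝ → E, ContDiff ℝ (⊤ : ℕ∞) v ∧ ∀ t ∈ U, w t = t ^ (k + 1) • v t := by
  suffices h : ∀ j ≤ k, ∃ v : ℝ → E, ContDiff ℝ (⊤ : ℕ∞) v ∧ ∀ t ∈ U, w t = t ^ (j + 1) • v t from
    h k le_rfl
  intro j
  induction j with
  | zero =>
    intro _
    obtain ⟨v, hv, h⟩ := exists_contDiff_eq_smul_of_apply_zero hw h0
    exact ⟨v, hv, fun t _ => by simpa using h t⟩
  | succ j ih =>
    intro hj
    obtain ⟨v, hv, h⟩ := ih (by omega)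
    obtain ⟨hvd, hv'⟩ := contDiff_infty_iff_deriv.mp hv
    obtain ⟨l, rfl⟩ := Nat.exists_eq_add_of_le hj
    refine ⟨fun t => ((j : ℝ) + 1)⁻¹ • (B t (v t) - deriv v t + t ^ l • r t), ?_, fun t ht => ?_⟩
    · exact (((hB.clm_apply hv).sub hv').add ((contDiff_id.pow l).smul hr)).const_smul _
    · rcases eq_or_ne t 0 with rfl | ht0
      · simp [h0]
      have hprod : HasDerivAt w (t ^ (j + 1) • deriv v t + (((j : ℝ) + 1) * t ^ j) • v t) t := by
        have := ((hasDerivAt_pow (j + 1) t).fun_smul (hvd t).hasDerivAt).congr_of_eventuallyEq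
          (f₁ := w) (by filter_upwards [hU.mem_nhds ht] with s hs using h s hs)
        simpa using this
      have heq := hprod.unique (hode t ht)
      rw [h t ht, map_smul] at heq
      have hj0 : (j : ℝ) + 1 ≠ 0 := by positivity
      have hv_eq : ((j : ℝ) + 1) • v t = t • (B t (v t) - deriv v t + t ^ l • r t) := by
        apply smul_right_injective E (pow_ne_zero j ht0)
        have heq' := eq_sub_of_add_eq' heq
        simp only [smul_smul, mul_comm (t ^ j)]
        rw [heq']
        module
      rw [h t ht, pow_succ t (j + 1), mul_smul, smul_comm t, ← hv_eq, inv_smul_smul₀ hj0]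

/-- Solvability of a linear ODE with forcing vanishing to order `k`: given smooth
`A : [0,ε] → M_N(ℝ)` and `r : [0,ε] → ℝ^N`, there is a smooth `wt` such that
`w(ρ) = ρ^{k+1} wt(ρ)` satisfies `w′(ρ) + A(ρ)·w(ρ) = ρ^k r(ρ)` for all `ρ ∈ [0,ε]`. -/
theorem linear_ode_vanishing_order_solution
    (ε : ℝ) (hε : 0 < ε) (N : ℕ) (hN : 1 ≤ N)
    (A : ℝ → Fin N → Fin N → ℝ) (r : ℝ → (Fin N → ℝ))
    (hA : ContDiff ℝ (⊤ : ℕ∞) A) (hr : ContDiff ℝ (⊤ : ℕ∞) r) (k : ℕ) :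
    ∃ wt : ℝ → (Fin N → ℝ), ContDiff ℝ (⊤ : ℕ∞) wt ∧
      ∀ ρ ∈ Set.Icc (0:ℝ) ε,
        HasDerivAt (fun s : ℝ => s ^ (k + 1) • wt s)
          (ρ ^ k • r ρ - (Matrix.of (A ρ)).mulVec (ρ ^ (k + 1) • wt ρ)) ρ := by
  let B : ℝ → (Fin N → ℝ) →L[ℝ] (Fin N → ℝ) :=
    fun t => -(Matrix.of (A t)).mulVecLin.toContinuousLinearMap
  have hB : ContDiff ℝ (⊤ : ℕ∞) B := by
    rw [contDiff_clm_apply_iff]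
    intro y
    have hA' : ∀ i j, ContDiff ℝ (⊤ : ℕ∞) fun t => A t i j := fun i j =>
      contDiff_pi.mp (contDiff_pi.mp hA i) j
    rw [contDiff_pi]
    intro i
    simp only [B, neg_apply, LinearMap.coe_toContinuousLinearMap', Matrix.mulVecLin_apply,
      Pi.neg_apply, Matrix.mulVec, dotProduct, Matrix.of_apply]
    exact (ContDiff.sum fun j _ => (hA' i j).mul contDiff_const).neg
  have hg : ContDiff ℝ (⊤ : ℕ∞) (fun t : ℝ => t ^ k • r t) := (contDiff_id.pow k).smul hr
  obtain ⟨w, hw0, hw⟩ := exists_hasDerivWithinAt_linear hB.continuous hg.continuous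
    (T := ε + 2) (by linarith)
  have hws : ContDiffOn ℝ (⊤ : ℕ∞) w (Set.Icc (-(ε + 2)) (ε + 2)) :=
    ODE.contDiffOn_enat_Icc_of_hasDerivWithinAt (f := fun t x => B t x + t ^ k • r t)
      (u := Set.univ) (ContDiff.contDiffOn
        (((hB.comp contDiff_fst).clm_apply contDiff_snd).add (hg.comp contDiff_fst)))
      hw (Set.mapsTo_univ _ _)
  obtain ⟨F, hF, hFw⟩ := exists_contDiff_eqOn_Icc (S := ε + 1) (by linarith) (by linarith) hws
  have hF0 : F 0 = 0 := (hFw ⟨by linarith, by linarith⟩).trans hw0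
  have hode : ∀ t ∈ Set.Ioo (-(ε + 1)) (ε + 1), HasDerivAt F (B t (F t) + t ^ k • r t) t := by
    intro t ht
    rw [hFw (Set.Ioo_subset_Icc_self ht)]
    refine ((hw t ⟨by linarith [ht.1], by linarith [ht.2]⟩).hasDerivAt
      (Icc_mem_nhds (by linarith [ht.1]) (by linarith [ht.2]))).congr_of_eventuallyEq ?_
    filter_upwards [isOpen_Ioo.mem_nhds ht] with s hs using hFw (Set.Ioo_subset_Icc_self hs)
  obtain ⟨v, hv, hFv⟩ := exists_contDiff_eq_pow_smul_of_hasDerivAt hB hr hF hF0 isOpen_Ioo hode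
  refine ⟨v, hv, fun ρ hρ => ?_⟩
  have hρ' : ρ ∈ Set.Ioo (-(ε + 1)) (ε + 1) := ⟨by linarith [hρ.1], by linarith [hρ.2]⟩
  have h := (hode ρ hρ').congr_of_eventuallyEq (f₁ := fun s : ℝ => s ^ (k + 1) • v s)
    (by filter_upwards [isOpen_Ioo.mem_nhds hρ'] with s hs using (hFv s hs).symm)
  rw [hFv ρ hρ'] at h
  refine h.congr_deriv ?_
  simp only [B, neg_apply, LinearMap.coe_toContinuousLinearMap', Matrix.mulVecLin_apply]
  abel
end

section
/- For every β > 1 and every R₀ > 1 there exists C > 0 such that for all R ≥ R₀, ∫₀^π (sin α)^{−1}·(log(R/ sin α))^{−β} dα ≤ C. (Note that log(R/sin α) ≥ log R₀ > 0 for α ∈ (0,π), so the integrand is well defined and positive.) -/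
open Real Filter Topology MeasureTheory

lemma log_div_sin_pos {R α : ℝ} (hR : 1 < R) (hα : α ∈ Set.Ioo 0 π) :
    0 < log (R / sin α) := by
  have hs := sin_pos_of_mem_Ioo hα
  refine log_pos ((one_lt_div hs).2 ?_)
  linarith [sin_le_one α]

lemma log_le_log_div_sin {R α : ℝ} (hR : 0 < R) (hα : α ∈ Set.Ioo 0 π) :
    log R ≤ log (R / sin α) :=
  log_le_log hR (le_div_self hR.le (sin_pos_of_mem_Ioo hα) (sin_le_one α))

lemma tendsto_log_div_sin_nhdsGT_zero {R : ℝ} (hR : 0 < R) :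
    Tendsto (fun α => log (R / sin α)) (𝓝[>] 0) atTop := by
  have hsin : Tendsto sin (𝓝[>] 0) (𝓝[>] 0) := by
    refine tendsto_nhdsWithin_iff.2 ⟨?_, ?_⟩
    · simpa using (continuous_sin.tendsto 0).mono_left nhdsWithin_le_nhds
    · filter_upwards [Ioo_mem_nhdsGT pi_pos] with x hx using sin_pos_of_mem_Ioo hx
  have h := (tendsto_inv_nhdsGT_zero.comp hsin).const_mul_atTop hR
  exact tendsto_log_atTop.comp (by simpa [Function.comp_def, div_eq_mul_inv] using h)

lemma hasDerivAt_log_div_sin_rpow {R β α : ℝ} (hR : 1 < R) (hβ : 1 < β)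
    (hα : α ∈ Set.Ioo 0 π) :
    HasDerivAt (fun x => log (R / sin x) ^ (1 - β) / (β - 1))
      (cos α / sin α * log (R / sin α) ^ (-β)) α := by
  have hs := sin_pos_of_mem_Ioo hα
  have hL := log_div_sin_pos hR hα
  have hR' : 0 < R := by linarith
  have hβ' : β - 1 ≠ 0 := by linarith
  have h1 : HasDerivAt (fun x => log (R / sin x)) (-(cos α / sin α)) α := by
    have h := (((hasDerivAt_const α R).div (hasDerivAt_sin α) hs.ne').log (div_pos hR' hs).ne')
    refine h.congr_deriv ?_
    simp only [Pi.div_apply]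
    field_simp
    ring
  refine ((h1.rpow_const (p := 1 - β) (Or.inl hL.ne')).div_const (β - 1)).congr_deriv ?_
  rw [show 1 - β - 1 = -β by ring]
  field_simp
  ring

lemma continuousOn_log_div_sin_rpow {R β : ℝ} (hR : 1 < R) (hβ : 1 < β) :
    ContinuousOn (fun x => log (R / sin x) ^ (1 - β) / (β - 1)) (Set.Icc 0 (π / 2)) := by
  intro x hx
  rcases hx.1.eq_or_lt with rfl | h0
  · refine (continuousWithinAt_Ioi_iff_Ici.1 ?_).mono Set.Icc_subset_Ici_self
    have h := ((tendsto_rpow_neg_atTop (sub_pos.2 hβ)).comp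
      (tendsto_log_div_sin_nhdsGT_zero (by linarith : 0 < R))).div_const (β - 1)
    simpa [ContinuousWithinAt, Function.comp_def, zero_rpow (by linarith : 1 - β ≠ 0)] using h
  · exact (hasDerivAt_log_div_sin_rpow hR hβ
      ⟨h0, by linarith [hx.2, pi_pos]⟩).continuousAt.continuousWithinAt

lemma measurable_inv_sin_mul_log_div_sin_rpow (R β : ℝ) :
    Measurable fun α : ℝ => (sin α)⁻¹ * log (R / sin α) ^ (-β) := by
  fun_prop

lemma inv_sin_le_cot_add_one {α : ℝ} (hα : α ∈ Set.Ioc 0 (π / 2)) :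
    (sin α)⁻¹ ≤ cos α / sin α + 1 := by
  have hs : 0 < sin α := sin_pos_of_mem_Ioo ⟨hα.1, by linarith [hα.2, pi_pos]⟩
  have hc : 0 ≤ cos α := cos_nonneg_of_mem_Icc ⟨by linarith [hα.1, pi_pos], hα.2⟩
  rw [div_add_one hs.ne', inv_eq_one_div]
  gcongr
  nlinarith [sin_sq_add_cos_sq α]

lemma integrableOn_inv_sin_mul_log_div_sin_rpow_half {R β : ℝ} (hR : 1 < R) (hβ : 1 < β) :
    IntegrableOn (fun α : ℝ => (sin α)⁻¹ * log (R / sin α) ^ (-β)) (Set.Ioc 0 (π / 2)) := by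
  have hcot : IntegrableOn (fun α => cos α / sin α * log (R / sin α) ^ (-β))
      (Set.Ioc 0 (π / 2)) := by
    refine intervalIntegral.integrableOn_deriv_of_nonneg
      (continuousOn_log_div_sin_rpow hR hβ) (fun x hx => ?_) (fun x hx => ?_)
    · exact hasDerivAt_log_div_sin_rpow hR hβ ⟨hx.1, by linarith [hx.2, pi_pos]⟩
    · have hx' : x ∈ Set.Ioo 0 π := ⟨hx.1, by linarith [hx.2, pi_pos]⟩
      have := sin_pos_of_mem_Ioo hx'
      have := log_div_sin_pos hR hx'
      have := cos_pos_of_mem_Ioo ⟨by linarith [hx.1, pi_pos], hx.2⟩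
      positivity
  have hconst : IntegrableOn (fun _ : ℝ => log R ^ (-β)) (Set.Ioc 0 (π / 2)) :=
    integrableOn_const measure_Ioc_lt_top.ne
  refine (hcot.add hconst).mono'
    (measurable_inv_sin_mul_log_div_sin_rpow R β).aestronglyMeasurable ?_
  filter_upwards [ae_restrict_mem measurableSet_Ioc] with x hx
  have hx' : x ∈ Set.Ioo 0 π := ⟨hx.1, by linarith [hx.2, pi_pos]⟩
  have hs := sin_pos_of_mem_Ioo hx'
  have hL := log_div_sin_pos hR hx'
  have hbound : log (R / sin x) ^ (-β) ≤ log R ^ (-β) :=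
    rpow_le_rpow_of_nonpos (log_pos hR) (log_le_log_div_sin (by linarith) hx') (by linarith)
  rw [norm_of_nonneg (by positivity)]
  calc (sin x)⁻¹ * log (R / sin x) ^ (-β)
      ≤ (cos x / sin x + 1) * log (R / sin x) ^ (-β) := by
        gcongr
        exact inv_sin_le_cot_add_one hx
    _ ≤ cos x / sin x * log (R / sin x) ^ (-β) + log R ^ (-β) := by linarith

lemma integrableOn_inv_sin_mul_log_div_sin_rpow {R β : ℝ} (hR : 1 < R) (hβ : 1 < β) :
    IntegrableOn (fun α : ℝ => (sin α)⁻¹ * log (R / sin α) ^ (-β)) (Set.Ioo 0 π) := by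
  have hπ := pi_pos
  have hleft : IntervalIntegrable (fun α : ℝ => (sin α)⁻¹ * log (R / sin α) ^ (-β))
      volume 0 (π / 2) :=
    (intervalIntegrable_iff_integrableOn_Ioc_of_le (by linarith)).2
      (integrableOn_inv_sin_mul_log_div_sin_rpow_half hR hβ)
  have hright := (hleft.comp_sub_left π).symm
  simp only [sin_pi_sub, sub_zero, sub_half] at hright
  exact ((intervalIntegrable_iff_integrableOn_Ioc_of_le hπ.le).1
    (hleft.trans hright)).mono_set Set.Ioo_subset_Ioc_self

/-- Uniform weighted estimate for short geodesics: for `β > 1` and `R₀ > 1` there is `C > 0`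
such that `∫₀^π (sin α)⁻¹ (log(R/sin α))^{−β} dα ≤ C` for every `R ≥ R₀` (and the integrand
is integrable on `(0,π)`). -/
theorem uniform_log_weight_integral_bound
    (β : ℝ) (hβ : 1 < β) (R₀ : ℝ) (hR₀ : 1 < R₀) :
    ∃ C : ℝ, 0 < C ∧ ∀ R : ℝ, R₀ ≤ R →
      IntegrableOn
        (fun α : ℝ => (Real.sin α)⁻¹ * Real.log (R / Real.sin α) ^ (-β)) (Set.Ioo 0 π) ∧
      (∫ α in Set.Ioo (0:ℝ) π, (Real.sin α)⁻¹ * Real.log (R / Real.sin α) ^ (-β)) ≤ C := by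
  have hnonneg : 0 ≤ ∫ α in Set.Ioo (0:ℝ) π, (sin α)⁻¹ * log (R₀ / sin α) ^ (-β) := by
    refine setIntegral_nonneg measurableSet_Ioo fun x hx => ?_
    have := sin_pos_of_mem_Ioo hx
    have := log_div_sin_pos hR₀ hx
    positivity
  refine ⟨(∫ α in Set.Ioo (0:ℝ) π, (sin α)⁻¹ * log (R₀ / sin α) ^ (-β)) + 1,
    by linarith, fun R hR => ?_⟩
  have hint := integrableOn_inv_sin_mul_log_div_sin_rpow (hR₀.trans_le hR) hβ
  refine ⟨hint, ?_⟩
  have hmono := setIntegral_mono_on hint (integrableOn_inv_sin_mul_log_div_sin_rpow hR₀ hβ)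
    measurableSet_Ioo fun x hx => by
      have hs := sin_pos_of_mem_Ioo hx
      have hle : log (R₀ / sin x) ≤ log (R / sin x) :=
        log_le_log (by positivity) (by gcongr)
      exact mul_le_mul_of_nonneg_left
        (rpow_le_rpow_of_nonpos (log_div_sin_pos hR₀ hx) hle (by linarith)) (by positivity)
  linarith
end
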